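/- arXiv:2506.13669 — 2 statements merged into one kernel-verified Lean document; each statement's English description precedes it below -/
import Mathlib

section
/- Let n ∈ ℕ, s ∈ (1,∞)\ℕ, k ∈ {0,…,[s]−1} with s ∈ (1, n+k+1), and let A be a Young function with ∫_0 (t/A(t))^{(s−(k+1))/(n−(s−(k+1)))} dt < ∞. If φ is an admissible function and c > 0 is a constant such that |u|_{𝓛^{k,φ}(ℝⁿ)} ≤ c |∇^{[s]}u|_{{s},A,ℝⁿ} for every u ∈ V^{s,A}_{d,k+1}(ℝⁿ), then there exists a constant c' > 0 such that ψ^k_{s,A}(r) ≤ c' φ(r) for all r > 0. Hence 𝓛^{k,ψ^k_{s,A}}(ℝⁿ) is the optimal k-th order Campanato target space. -/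
open MeasureTheory Metric Set Filter
open scoped ENNReal Topology

noncomputable section

/-- Euclidean space `ℝⁿ`. -/
abbrev Euc (n : ℕ) := EuclideanSpace ℝ (Fin n)

/-- A Young function: convex, left-continuous, vanishing at `0`,
non-constant on `(0,∞)`, with values in `[0,∞]`. -/
def IsYoung (A : ℝ → ℝ≥0∞) : Prop :=
  A 0 = 0 ∧
  (∀ x y t : ℝ, 0 ≤ x → 0 ≤ y → 0 ≤ t → t ≤ 1 →
      A (t * x + (1 - t) * y) ≤ ENNReal.ofReal t * A x + ENNReal.ofReal (1 - t) * A y) ∧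
  (∀ t : ℝ, 0 < t → ContinuousWithinAt A (Set.Iic t) t) ∧
  (∃ t₁ t₂ : ℝ, 0 < t₁ ∧ 0 < t₂ ∧ A t₁ ≠ A t₂)

/-- The right-continuous generalized inverse of a monotone function `A : [0,∞) → [0,∞]`. -/
def rcInv (A : ℝ → ℝ≥0∞) (v : ℝ≥0∞) : ℝ :=
  sInf {τ : ℝ | 0 ≤ τ ∧ v < A τ}

/-- The Young conjugate `Ã(t) = sup {τ t - A(τ) : τ ≥ 0}`. -/
def youngConj (A : ℝ → ℝ≥0∞) (t : ℝ) : ℝ≥0∞ :=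
  ⨆ (τ : ℝ) (_ : 0 ≤ τ), ENNReal.ofReal (τ * t) - A τ

/-- The functional `J_{σ,A}(v)` for a vector-valued `v`, with the Euclidean norm. -/
def Jfun (n : ℕ) (σ : ℝ) (A : ℝ → ℝ≥0∞) {ι : Type} [Fintype ι]
    (v : Euc n → ι → ℝ) : ℝ≥0∞ :=
  ∫⁻ x : Euc n, ∫⁻ y : Euc n,
    A (Real.sqrt (∑ i, (v x i - v y i) ^ 2) / ‖x - y‖ ^ σ) /
      ENNReal.ofReal (‖x - y‖ ^ (n : ℝ))

/-- The fractional Orlicz–Sobolev seminorm `|v|_{σ,A,ℝⁿ}` (vector-valued version). -/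
def fracSem (n : ℕ) (σ : ℝ) (A : ℝ → ℝ≥0∞) {ι : Type} [Fintype ι]
    (v : Euc n → ι → ℝ) : ℝ≥0∞ :=
  sInf (ENNReal.ofReal '' {lam : ℝ | 0 < lam ∧ Jfun n σ A (fun x i => v x i / lam) ≤ 1})

/-- The fractional Orlicz–Sobolev seminorm `|u|_{σ,A,ℝⁿ}` of a scalar function. -/
def fracSemS (n : ℕ) (σ : ℝ) (A : ℝ → ℝ≥0∞) (u : Euc n → ℝ) : ℝ≥0∞ :=
  fracSem n σ A (fun x (_ : Fin 1) => u x)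

/-- The normalized mean oscillation `φ(|B|^{1/n})⁻¹ ⨍_B |u - u_B|` over the ball `B = B(x,r)`. -/
def oscQuot (n : ℕ) (φ : ℝ → ℝ) (u : Euc n → ℝ) (x : Euc n) (r : ℝ) : ℝ :=
  (φ ((volume (ball x r)).toReal ^ ((n : ℝ)⁻¹)))⁻¹ *
    ⨍ y in ball x r, |u y - ⨍ z in ball x r, u z|

/-- The Campanato seminorm `|u|_{𝓛^φ(ℝⁿ)}`. -/
def campSem (n : ℕ) (φ : ℝ → ℝ) (u : Euc n → ℝ) : ℝ≥0∞ :=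
  ⨆ (x : Euc n) (r : ℝ) (_ : 0 < r), ENNReal.ofReal (oscQuot n φ u x r)

/-- The Campanato quantity restricted to balls of measure at most `r`. -/
def campSemSmall (n : ℕ) (φ : ℝ → ℝ) (u : Euc n → ℝ) (r : ℝ) : ℝ≥0∞ :=
  ⨆ (x : Euc n) (ρ : ℝ) (_ : 0 < ρ) (_ : volume (ball x ρ) ≤ ENNReal.ofReal r),
    ENNReal.ofReal (oscQuot n φ u x ρ)

/-- `φ : (0,∞) → (0,∞)` is admissible: positive and bounded below away from zero on `[a,∞)`. -/
def Admissible (φ : ℝ → ℝ) : Prop :=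
  (∀ r : ℝ, 0 < r → 0 < φ r) ∧
  ∀ a : ℝ, 0 < a → ∃ ε : ℝ, 0 < ε ∧ ∀ r : ℝ, a ≤ r → ε ≤ φ r

/-- `φ_{s,A}(r) = r^s A⁻¹(r^{-n})`. -/
def phiSA (n : ℕ) (s : ℝ) (A : ℝ → ℝ≥0∞) (r : ℝ) : ℝ :=
  r ^ s * rcInv A (ENNReal.ofReal (r ^ (-(n : ℝ))))

/-- `u` is `m`-times weakly differentiable, with iterated weak partial
derivatives recorded by `D`. -/
def HasWeakDerivs (n m : ℕ) (u : Euc n → ℝ)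
    (D : (h : ℕ) → Euc n → (Fin h → Fin n) → ℝ) : Prop :=
  (∀ x d, D 0 x d = u x) ∧
  ∀ h : ℕ, h ≤ m → ∀ dirs : Fin h → Fin n,
    LocallyIntegrable (fun x => D h x dirs) volume ∧
    ∀ φ : Euc n → ℝ, ContDiff ℝ (⊤ : ℕ∞) φ → HasCompactSupport φ →
      ∫ x : Euc n, u x *
          iteratedFDeriv ℝ h φ x (fun i => EuclideanSpace.single (dirs i) (1 : ℝ)) =
        (-1 : ℝ) ^ h * ∫ x : Euc n, D h x dirs * φ x

/-- The Euclidean length `|∇^h u|(x)` of the `h`-th order weak gradient. -/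
def gradLen (n : ℕ) (D : (h : ℕ) → Euc n → (Fin h → Fin n) → ℝ) (h : ℕ) (x : Euc n) : ℝ :=
  Real.sqrt (∑ d : Fin h → Fin n, (D h x d) ^ 2)

/-- The derivatives of orders `k, …, m` decay near infinity:
`|{|∇^h u| > t}| < ∞` for every `t > 0`. -/
def DecayFrom (n k m : ℕ) (D : (h : ℕ) → Euc n → (Fin h → Fin n) → ℝ) : Prop :=
  ∀ h : ℕ, k ≤ h → h ≤ m → ∀ t : ℝ, 0 < t →
    volume {x : Euc n | t < gradLen n D h x} < ⊤

/-- The Young function `F_k(t) = t^{n/(n-s+k+1)} ∫_0^t Ã(τ) τ^{-1-n/(n-s+k+1)} dτ`. -/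
def Fk (n : ℕ) (s : ℝ) (k : ℕ) (A : ℝ → ℝ≥0∞) (t : ℝ) : ℝ≥0∞ :=
  ENNReal.ofReal (t ^ ((n : ℝ) / ((n : ℝ) - s + (k : ℝ) + 1))) *
    ∫⁻ τ in Set.Ioc (0 : ℝ) t,
      youngConj A τ * ENNReal.ofReal (τ ^ (-1 - (n : ℝ) / ((n : ℝ) - s + (k : ℝ) + 1)))

/-- `ψ^k_{s,A}(r) = 1 / (r^{n-s+k} F_k⁻¹(r^{-n}))`. -/
def psiK (n : ℕ) (s : ℝ) (k : ℕ) (A : ℝ → ℝ≥0∞) (r : ℝ) : ℝ :=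
  (r ^ ((n : ℝ) - s + (k : ℝ)) * rcInv (Fk n s k A) (ENNReal.ofReal (r ^ (-(n : ℝ)))))⁻¹

/-- `ψ^{[s]}_{s,A}(r) = r^{{s}} A⁻¹(r^{-n})`. -/
def psiTop (n : ℕ) (s : ℝ) (A : ℝ → ℝ≥0∞) (r : ℝ) : ℝ :=
  r ^ (s - (⌊s⌋₊ : ℝ)) * rcInv A (ENNReal.ofReal (r ^ (-(n : ℝ))))

/-- Convergence near zero of `∫_0 (t/A(t))^{(s-(k+1))/(n-(s-(k+1)))} dt`. -/
def IntCondK (n : ℕ) (s : ℝ) (k : ℕ) (A : ℝ → ℝ≥0∞) : Prop :=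
  ∃ ε : ℝ, 0 < ε ∧
    ∫⁻ t in Set.Ioc (0 : ℝ) ε,
      (ENNReal.ofReal t / A t) ^ ((s - (k : ℝ) - 1) / ((n : ℝ) - (s - (k : ℝ) - 1))) < ⊤

/-- `P` is the projection polynomial `P^k_B[u]`: it has degree at most `k` and its
derivatives up to order `k` match, in the mean over `B`, the weak derivatives `D` of `u`. -/
def IsCampPoly (n k : ℕ) (D : (h : ℕ) → Euc n → (Fin h → Fin n) → ℝ)
    (B : Set (Euc n)) (P : MvPolynomial (Fin n) ℝ) : Prop :=
  P.totalDegree ≤ k ∧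
  ∀ h : ℕ, h ≤ k → ∀ dirs : Fin h → Fin n,
    ∫ x in B, D h x dirs =
      ∫ x in B,
        iteratedFDeriv ℝ h (fun y : Euc n => MvPolynomial.eval (fun i => y i) P) x
          (fun i => EuclideanSpace.single (dirs i) (1 : ℝ))

/-- The normalized oscillation of order `k` over the ball `B(x,r)`. -/
def oscQuotK (n k : ℕ) (φ : ℝ → ℝ) (u : Euc n → ℝ)
    (D : (h : ℕ) → Euc n → (Fin h → Fin n) → ℝ) (x : Euc n) (r : ℝ) : ℝ≥0∞ :=
  ⨅ (P : MvPolynomial (Fin n) ℝ) (_ : IsCampPoly n k D (ball x r) P),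
    ENNReal.ofReal
      ((φ ((volume (ball x r)).toReal ^ ((n : ℝ)⁻¹)) *
          (volume (ball x r)).toReal ^ ((k : ℝ) / (n : ℝ)))⁻¹ *
        ⨍ y in ball x r, |u y - MvPolynomial.eval (fun i => y i) P|)

/-- The `k`-th order Campanato seminorm `|u|_{𝓛^{k,φ}(ℝⁿ)}`. -/
def campSemK (n k : ℕ) (φ : ℝ → ℝ) (u : Euc n → ℝ)
    (D : (h : ℕ) → Euc n → (Fin h → Fin n) → ℝ) : ℝ≥0∞ :=
  ⨆ (x : Euc n) (r : ℝ) (_ : 0 < r), oscQuotK n k φ u D x r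

/-- The `k`-th order Campanato quantity restricted to balls of measure at most `r`. -/
def campSemKSmall (n k : ℕ) (φ : ℝ → ℝ) (u : Euc n → ℝ)
    (D : (h : ℕ) → Euc n → (Fin h → Fin n) → ℝ) (r : ℝ) : ℝ≥0∞ :=
  ⨆ (x : Euc n) (ρ : ℝ) (_ : 0 < ρ) (_ : volume (ball x ρ) ≤ ENNReal.ofReal r),
    oscQuotK n k φ u D x ρ

/-- The Luxemburg norm `‖f‖_{L^A(μ)}`. -/
def luxNorm {α : Type*} [MeasurableSpace α] (A : ℝ → ℝ≥0∞) (μ : Measure α)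
    (f : α → ℝ) : ℝ≥0∞ :=
  sInf (ENNReal.ofReal '' {lam : ℝ | 0 < lam ∧ ∫⁻ x, A (|f x| / lam) ∂μ ≤ 1})

/-- Iterated integral `∫_r^∞ ∫_{r_1}^∞ ⋯ g`. -/
def iterInt : ℕ → (ℝ → ℝ) → (ℝ → ℝ)
  | 0, g => g
  | j + 1, g => fun r => ∫ t in Set.Ioi r, iterInt j g t

end

/-- A Young function is star-shaped with respect to the origin. -/
theorem IsYoung.apply_mul_le {A : ℝ → ℝ≥0∞} (hA : IsYoung A) {t x : ℝ} (ht0 : 0 ≤ t)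
    (ht1 : t ≤ 1) (hx : 0 ≤ x) : A (t * x) ≤ ENNReal.ofReal t * A x := by
  simpa [hA.1] using hA.2.1 x 0 t hx le_rfl ht0 ht1

theorem IsYoung.mono {A : ℝ → ℝ≥0∞} (hA : IsYoung A) {x y : ℝ} (hx : 0 ≤ x) (hxy : x ≤ y) :
    A x ≤ A y := by
  rcases hx.eq_or_lt with rfl | hx'
  · simp [hA.1]
  have hy : 0 < y := hx'.trans_le hxy
  have h := hA.apply_mul_le (t := x / y) (x := y) (by positivity) ((div_le_one hy).2 hxy) hy.le
  rw [div_mul_cancel₀ _ hy.ne'] at h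
  refine h.trans ?_
  calc ENNReal.ofReal (x / y) * A y ≤ 1 * A y := by
        gcongr
        exact ENNReal.ofReal_le_one.2 ((div_le_one hy).2 hxy)
    _ = A y := one_mul _

/-- Jensen's inequality for a Young function and finitely many sub-probability weights. -/
theorem IsYoung.sum_le {A : ℝ → ℝ≥0∞} (hA : IsYoung A) {ι : Type*} (t : Finset ι)
    (w g : ι → ℝ) (hw : ∀ i, 0 ≤ w i) (hg : ∀ i, 0 ≤ g i) (hsum : ∑ i ∈ t, w i ≤ 1) :
    A (∑ i ∈ t, w i * g i) ≤ ∑ i ∈ t, ENNReal.ofReal (w i) * A (g i) := by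
  classical
  induction t using Finset.induction_on generalizing w with
  | empty => simp [hA.1]
  | insert a t ha ih =>
    rw [Finset.sum_insert ha] at hsum ⊢
    rw [Finset.sum_insert ha]
    have hrest : 0 ≤ ∑ i ∈ t, w i := Finset.sum_nonneg fun i _ => hw i
    rcases lt_or_ge (w a) 1 with h1 | h1
    · have hpos : 0 < 1 - w a := by linarith
      have hW : ∑ i ∈ t, w i / (1 - w a) ≤ 1 := by
        rw [← Finset.sum_div, div_le_one hpos]
        linarith
      have key := hA.2.1 (g a) (∑ i ∈ t, w i / (1 - w a) * g i) (w a) (hg a)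
        (Finset.sum_nonneg fun i _ => mul_nonneg (div_nonneg (hw i) hpos.le) (hg i)) (hw a) h1.le
      have e : (1 - w a) * ∑ i ∈ t, w i / (1 - w a) * g i = ∑ i ∈ t, w i * g i := by
        rw [Finset.mul_sum]
        refine Finset.sum_congr rfl fun i _ => ?_
        field_simp
      rw [e] at key
      refine key.trans ?_
      gcongr
      calc ENNReal.ofReal (1 - w a) * A (∑ i ∈ t, w i / (1 - w a) * g i)
          ≤ ENNReal.ofReal (1 - w a) *
              ∑ i ∈ t, ENNReal.ofReal (w i / (1 - w a)) * A (g i) := by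
            gcongr
            exact ih (fun i => w i / (1 - w a)) (fun i => div_nonneg (hw i) hpos.le) hW
        _ = ∑ i ∈ t, ENNReal.ofReal (w i) * A (g i) := by
            rw [Finset.mul_sum]
            refine Finset.sum_congr rfl fun i _ => ?_
            rw [← mul_assoc, ← ENNReal.ofReal_mul hpos.le, mul_div_cancel₀ _ hpos.ne']
    · have h0 : ∑ i ∈ t, w i = 0 := by linarith
      have hz : ∀ i ∈ t, w i = 0 := (Finset.sum_eq_zero_iff_of_nonneg fun i _ => hw i).1 h0
      have ha1 : w a = 1 := by linarith
      rw [Finset.sum_eq_zero fun i hi => by rw [hz i hi, zero_mul], ha1]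
      simp

/-- Iterated integration by parts. The order of the directions is reversed. -/
theorem integral_mul_iteratedFDeriv_eq {n : ℕ} (h : ℕ) (v : Fin h → Euc n) (u ψ : Euc n → ℝ)
    (hu : ContDiff ℝ (⊤ : ℕ∞) u) (hψ : ContDiff ℝ (⊤ : ℕ∞) ψ) (hc : HasCompactSupport ψ) :
    ∫ x, u x * iteratedFDeriv ℝ h ψ x v =
      (-1 : ℝ) ^ h * ∫ x, iteratedFDeriv ℝ h u x (v ∘ Fin.rev) * ψ x := by
  induction h generalizing u with
  | zero => simp
  | succ h ih =>
    have hψh : ContDiff ℝ (⊤ : ℕ∞) (iteratedFDeriv ℝ h ψ) :=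
      hψ.iteratedFDeriv_right (m := (⊤ : ℕ∞)) (by exact_mod_cast le_top)
    set g : Euc n → ℝ := fun y => iteratedFDeriv ℝ h ψ y (Fin.tail v) with hg_def
    have hg : ContDiff ℝ (⊤ : ℕ∞) g :=
      (ContinuousMultilinearMap.apply ℝ (fun _ : Fin h => Euc n) ℝ (Fin.tail v)).contDiff.comp hψh
    have hgc : HasCompactSupport g := (hc.iteratedFDeriv (𝕜 := ℝ) h).comp_left
      (g := fun L : ContinuousMultilinearMap ℝ (fun _ : Fin h => Euc n) ℝ => L (Fin.tail v)) rfl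
    set w : Euc n → ℝ := fun y => fderiv ℝ u y (v 0) with hw_def
    have hfu : ContDiff ℝ (⊤ : ℕ∞) (fderiv ℝ u) := hu.fderiv_right (by simp)
    have hw : ContDiff ℝ (⊤ : ℕ∞) w := hfu.clm_apply contDiff_const
    have hfg : Continuous fun y => fderiv ℝ g y (v 0) :=
      ((hg.fderiv_right (m := (⊤ : ℕ∞)) (by simp)).clm_apply contDiff_const).continuous
    have h1 : ∀ x, iteratedFDeriv ℝ (h + 1) ψ x v = fderiv ℝ g x (v 0) := fun x =>
      DifferentiableAt.iteratedFDeriv_succ_apply_left' (hψh.differentiable (by simp) x)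
    have h2 : ∀ x, iteratedFDeriv ℝ (h + 1) u x (v ∘ Fin.rev) =
        iteratedFDeriv ℝ h w x (Fin.tail v ∘ Fin.rev) := by
      intro x
      rw [iteratedFDeriv_succ_apply_right]
      have := (ContinuousLinearMap.apply ℝ ℝ (v 0)).iteratedFDeriv_comp_left
        (f := fderiv ℝ u) (x := x) (hfu.contDiffAt) (i := h) (by exact_mod_cast le_top)
      have e : w = (ContinuousLinearMap.apply ℝ ℝ (v 0)) ∘ fderiv ℝ u := rfl
      rw [e, this]
      have e2 : Fin.init (v ∘ Fin.rev) = Fin.tail v ∘ Fin.rev := by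
        ext i
        simp [Fin.init, Fin.tail, Fin.rev_castSucc]
      rw [e2]
      simp
    simp_rw [h1, h2]
    rw [integral_mul_fderiv_eq_neg_fderiv_mul_of_integrable]
    · have := ih (Fin.tail v) w hw
      rw [this, pow_succ]
      ring
    · exact (hw.continuous.mul hg.continuous).integrable_of_hasCompactSupport hgc.mul_left
    · exact (hu.continuous.mul hfg).integrable_of_hasCompactSupport
        (((hgc.fderiv ℝ).comp_left (g := fun L : Euc n →L[ℝ] ℝ => L (v 0)) rfl).mul_left)
    · exact (hu.continuous.mul hg.continuous).integrable_of_hasCompactSupport hgc.mul_left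
    · exact fun x _ => hu.differentiable (by simp) x
    · exact fun x _ => hg.differentiable (by simp) x

/-- The coordinates of the `h`-th derivative of `u`, with the directions listed in reverse order. -/
noncomputable def derivCoord {n : ℕ} (u : Euc n → ℝ) (h : ℕ) (x : Euc n)
    (dirs : Fin h → Fin n) : ℝ :=
  iteratedFDeriv ℝ h u x ((fun i => EuclideanSpace.single (dirs i) (1 : ℝ)) ∘ Fin.rev)

theorem contDiff_derivCoord {n : ℕ} {u : Euc n → ℝ} (hu : ContDiff ℝ (⊤ : ℕ∞) u) (h : ℕ)
    (dirs : Fin h → Fin n) : ContDiff ℝ (⊤ : ℕ∞) fun x => derivCoord u h x dirs :=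
  (ContinuousMultilinearMap.apply ℝ (fun _ : Fin h => Euc n) ℝ _).contDiff.comp
    (hu.iteratedFDeriv_right (m := (⊤ : ℕ∞)) (by exact_mod_cast le_top))

theorem derivCoord_eq_zero_of_notMem {n : ℕ} {u : Euc n → ℝ} {h : ℕ} {x : Euc n}
    (hx : x ∉ tsupport u) (dirs : Fin h → Fin n) : derivCoord u h x dirs = 0 := by
  have : iteratedFDeriv ℝ h u x = 0 := by
    by_contra hne
    exact hx (support_iteratedFDeriv_subset h hne)
  simp [derivCoord, this]

theorem hasWeakDerivs_derivCoord {n : ℕ} (m : ℕ) {u : Euc n → ℝ} (hu : ContDiff ℝ (⊤ : ℕ∞) u) :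
    HasWeakDerivs n m u (derivCoord u) := by
  refine ⟨fun x d => by simp [derivCoord], fun h _ dirs => ⟨?_, fun ψ hψ hc => ?_⟩⟩
  · exact (contDiff_derivCoord hu h dirs).continuous.locallyIntegrable
  · exact integral_mul_iteratedFDeriv_eq h _ u ψ hu hψ hc

theorem decayFrom_derivCoord {n : ℕ} (k m : ℕ) {u : Euc n → ℝ} (hc : HasCompactSupport u) :
    DecayFrom n k m (derivCoord u) := by
  intro h _ _ t ht
  refine (measure_mono fun x hx => ?_).trans_lt hc.isCompact.measure_lt_top
  by_contra hxu
  have : gradLen n (derivCoord u) h x = 0 := by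
    simp [gradLen, derivCoord_eq_zero_of_notMem hxu]
  exact absurd hx (by simp [this, ht.le])

theorem exists_sum_dyadic_min_le {θ : ℝ} (h0 : 0 < θ) (h1 : θ < 1) :
    ∃ M : ℝ, 0 < M ∧ ∀ t : ℝ, 0 < t → ∀ N : ℕ,
      ∑ j ∈ Finset.range N, min ((2 ^ j * t) ^ θ) ((2 ^ j * t) ^ (θ - 1)) ≤ M := by
  have ha : 0 < (2 : ℝ) ^ θ - 1 := sub_pos.2 (Real.one_lt_rpow (by norm_num) h0)
  have hb : 0 < 1 - (2 : ℝ) ^ (θ - 1) :=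
    sub_pos.2 (Real.rpow_lt_one_of_one_lt_of_neg (by norm_num) (by linarith))
  set G : ℝ → ℝ := fun t =>
    min t 2 ^ θ / (2 ^ θ - 1) - max t 1 ^ (θ - 1) / (1 - 2 ^ (θ - 1)) with hG
  have hstep : ∀ t : ℝ, 0 < t → min (t ^ θ) (t ^ (θ - 1)) ≤ G (2 * t) - G t := by
    intro t ht
    have m1 : min t 2 ^ θ ≤ min (2 * t) 2 ^ θ :=
      Real.rpow_le_rpow (by positivity) (min_le_min_right _ (by linarith)) h0.le
    have m2 : max (2 * t) 1 ^ (θ - 1) ≤ max t 1 ^ (θ - 1) :=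
      Real.rpow_le_rpow_of_nonpos (by positivity) (max_le_max_right _ (by linarith)) (by linarith)
    have e : G (2 * t) - G t = (min (2 * t) 2 ^ θ - min t 2 ^ θ) / (2 ^ θ - 1) +
        (max t 1 ^ (θ - 1) - max (2 * t) 1 ^ (θ - 1)) / (1 - 2 ^ (θ - 1)) := by
      simp only [hG]; ring
    rw [e]
    have p1 := div_nonneg (sub_nonneg.2 m1) ha.le
    have p2 := div_nonneg (sub_nonneg.2 m2) hb.le
    rcases le_total t 1 with h | h
    · refine (min_le_left _ _).trans (le_trans (le_of_eq ?_) (le_add_of_nonneg_right p2))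
      rw [min_eq_left (by linarith), min_eq_left (by linarith),
        Real.mul_rpow (by norm_num) ht.le, eq_div_iff ha.ne']
      ring
    · refine (min_le_right _ _).trans (le_trans (le_of_eq ?_) (le_add_of_nonneg_left p1))
      rw [max_eq_left h, max_eq_left (by linarith),
        Real.mul_rpow (by norm_num) ht.le, eq_div_iff hb.ne']
      ring
  refine ⟨2 ^ θ / (2 ^ θ - 1) + 1 / (1 - 2 ^ (θ - 1)), by positivity, fun t ht N => ?_⟩
  have hsum : ∑ j ∈ Finset.range N, min ((2 ^ j * t) ^ θ) ((2 ^ j * t) ^ (θ - 1)) ≤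
      G (2 ^ N * t) - G t := by
    have := Finset.sum_range_sub (fun j : ℕ => G (2 ^ j * t)) N
    rw [pow_zero, one_mul] at this
    rw [← this]
    refine Finset.sum_le_sum fun j _ => ?_
    rw [pow_succ', mul_assoc]
    exact hstep _ (by positivity)
  refine hsum.trans ?_
  have q1 : min (2 ^ N * t) 2 ^ θ / (2 ^ θ - 1) ≤ 2 ^ θ / (2 ^ θ - 1) := by
    gcongr
    exact min_le_right _ _
  have q2 : max t 1 ^ (θ - 1) / (1 - 2 ^ (θ - 1)) ≤ 1 / (1 - 2 ^ (θ - 1)) := by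
    gcongr
    exact Real.rpow_le_one_of_one_le_of_nonpos (le_max_right _ _) (by linarith)
  have q3 : 0 ≤ min t 2 ^ θ / (2 ^ θ - 1) := by positivity
  have q4 : 0 ≤ max (2 ^ N * t) 1 ^ (θ - 1) / (1 - 2 ^ (θ - 1)) := by positivity
  simp only [hG]
  linarith

/-- The scale-invariant bound for dyadic superpositions of dilates of a bounded Lipschitz map. -/
theorem exists_sum_dilates_le {θ : ℝ} (h0 : 0 < θ) (h1 : θ < 1) {E F : Type*}
    [NormedAddCommGroup E] [NormedSpace ℝ E] [NormedAddCommGroup F] (Φ : E → F) (B : ℝ)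
    (hB : 0 ≤ B) (hbd : ∀ x y, ‖Φ x - Φ y‖ ≤ B) (hlip : ∀ x y, ‖Φ x - Φ y‖ ≤ B * ‖x - y‖) :
    ∃ M : ℝ, 0 < M ∧ ∀ R : ℝ, 0 < R → ∀ N : ℕ, ∀ x y : E,
      ∑ j ∈ Finset.range N, (2 ^ j * R) ^ θ *
        ‖Φ ((2 ^ j * R)⁻¹ • x) - Φ ((2 ^ j * R)⁻¹ • y)‖ / ‖x - y‖ ^ θ ≤ M := by
  obtain ⟨M, hM, hMs⟩ := exists_sum_dyadic_min_le h0 h1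
  refine ⟨B * M + 1, by positivity, fun R hR N x y => ?_⟩
  rcases eq_or_ne x y with rfl | hxy
  · simp only [sub_self, norm_zero, mul_zero, zero_div, Finset.sum_const_zero]
    positivity
  have hd : 0 < ‖x - y‖ := norm_pos_iff.2 (sub_ne_zero.2 hxy)
  calc ∑ j ∈ Finset.range N, (2 ^ j * R) ^ θ *
        ‖Φ ((2 ^ j * R)⁻¹ • x) - Φ ((2 ^ j * R)⁻¹ • y)‖ / ‖x - y‖ ^ θ
      ≤ ∑ j ∈ Finset.range N, B * min ((2 ^ j * (R / ‖x - y‖)) ^ θ)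
          ((2 ^ j * (R / ‖x - y‖)) ^ (θ - 1)) := by
        refine Finset.sum_le_sum fun j _ => ?_
        have hρ : 0 < 2 ^ j * R := by positivity
        set ρ := 2 ^ j * R
        have e : 2 ^ j * (R / ‖x - y‖) = ρ / ‖x - y‖ := by simp only [ρ]; ring
        have hlip' := hlip (ρ⁻¹ • x) (ρ⁻¹ • y)
        rw [← smul_sub, norm_smul, Real.norm_of_nonneg (by positivity)] at hlip'
        rw [e, mul_min_of_nonneg _ _ hB, le_min_iff, Real.rpow_sub_one (by positivity),
          Real.div_rpow hρ.le hd.le]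
        constructor
        · calc ρ ^ θ * ‖Φ (ρ⁻¹ • x) - Φ (ρ⁻¹ • y)‖ / ‖x - y‖ ^ θ ≤ ρ ^ θ * B / ‖x - y‖ ^ θ := by
                gcongr
                exact hbd _ _
            _ = _ := by ring
        · calc ρ ^ θ * ‖Φ (ρ⁻¹ • x) - Φ (ρ⁻¹ • y)‖ / ‖x - y‖ ^ θ
              ≤ ρ ^ θ * (B * (ρ⁻¹ * ‖x - y‖)) / ‖x - y‖ ^ θ := by gcongr
            _ = _ := by field_simp
    _ ≤ B * M := by
        rw [← Finset.mul_sum]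
        gcongr
        exact hMs _ (by positivity) N
    _ ≤ B * M + 1 := by linarith

/-- The integrand of the Gagliardo seminorm `W^{θ,1}`. -/
noncomputable def gagliardoKernel (n : ℕ) (θ : ℝ) {F : Type*} [NormedAddCommGroup F]
    (Φ : Euc n → F) (x y : Euc n) : ℝ≥0∞ :=
  ENNReal.ofReal (‖Φ x - Φ y‖ / (‖x - y‖ ^ θ * ‖x - y‖ ^ (n : ℝ)))

theorem measurable_gagliardoKernel {n : ℕ} {θ : ℝ} {F : Type*} [NormedAddCommGroup F]
    {Φ : Euc n → F} (hΦ : Continuous Φ) :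
    Measurable (Function.uncurry (gagliardoKernel n θ Φ)) := by
  have h1 : Measurable fun p : Euc n × Euc n => ‖Φ p.1 - Φ p.2‖ :=
    ((hΦ.comp continuous_fst).sub (hΦ.comp continuous_snd)).norm.measurable
  have h2 : Measurable fun p : Euc n × Euc n => ‖p.1 - p.2‖ :=
    (continuous_fst.sub continuous_snd).norm.measurable
  exact (h1.div ((h2.pow_const _).mul (h2.pow_const _))).ennreal_ofReal

theorem lintegral_min_kernel_lt_top {n : ℕ} (hn : 0 < n) {θ : ℝ} (h0 : 0 < θ) (h1 : θ < 1)
    (B : ℝ) :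
    ∫⁻ z : Euc n, ENNReal.ofReal (B * min 1 ‖z‖ / (‖z‖ ^ θ * ‖z‖ ^ (n : ℝ))) < ⊤ := by
  have : Nonempty (Fin n) := ⟨⟨0, hn⟩⟩
  have hint : Integrable (fun z : Euc n =>
      (fun y : ℝ => B * min 1 y / (y ^ θ * y ^ (n : ℝ))) ‖z‖) volume := by
    refine (integrable_fun_norm_addHaar (volume : Measure (Euc n))
      (f := fun y : ℝ => B * min 1 y / (y ^ θ * y ^ (n : ℝ)))).2 ?_
    simp only [finrank_euclideanSpace, Fintype.card_fin, smul_eq_mul]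
    have e : ∀ y : ℝ, 0 < y → y ^ (n - 1) * (B * min 1 y / (y ^ θ * y ^ (n : ℝ))) =
        B * min 1 y * y ^ (-θ - 1) := by
      intro y hy
      have : y ^ (-θ - 1) = y ^ (n - 1) / (y ^ θ * y ^ (n : ℝ)) := by
        rw [← Real.rpow_add hy, ← Real.rpow_natCast y (n - 1), ← Real.rpow_sub hy]
        congr 1
        rw [Nat.cast_sub hn]
        push_cast
        ring
      rw [this]
      ring
    rw [← Ioc_union_Ioi_eq_Ioi (zero_le_one' ℝ), integrableOn_union]
    constructor
    · have hi : IntegrableOn (fun y : ℝ => y ^ (-θ)) (Ioc 0 1) :=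
        (intervalIntegrable_iff_integrableOn_Ioc_of_le zero_le_one).1
          (intervalIntegral.intervalIntegrable_rpow' (by linarith))
      refine IntegrableOn.congr_fun (hi.const_mul B) (fun y hy => ?_) measurableSet_Ioc
      rw [e y hy.1, min_eq_right hy.2, Real.rpow_sub_one hy.1.ne']
      field_simp [hy.1.ne']
    · have hi : IntegrableOn (fun y : ℝ => y ^ (-θ - 1)) (Ioi 1) :=
        integrableOn_Ioi_rpow_of_lt (by linarith) one_pos
      refine IntegrableOn.congr_fun (hi.const_mul B) (fun y hy => ?_) measurableSet_Ioi
      have hy' : (1 : ℝ) < y := hy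
      rw [e y (by linarith), min_eq_left hy'.le, mul_one]
  exact hint.lintegral_lt_top

theorem lintegral_gagliardoKernel_lt_top {n : ℕ} (hn : 0 < n) {θ : ℝ} (h0 : 0 < θ) (h1 : θ < 1)
    {F : Type*} [NormedAddCommGroup F] (Φ : Euc n → F) (B : ℝ) (hB : 0 ≤ B)
    (hc : HasCompactSupport Φ)
    (hbd : ∀ x y, ‖Φ x - Φ y‖ ≤ B) (hlip : ∀ x y, ‖Φ x - Φ y‖ ≤ B * ‖x - y‖) :
    ∫⁻ x, ∫⁻ y, gagliardoKernel n θ Φ x y < ⊤ := by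
  set κ : Euc n → ℝ≥0∞ :=
    fun z => ENNReal.ofReal (B * min 1 ‖z‖ / (‖z‖ ^ θ * ‖z‖ ^ (n : ℝ))) with hκ
  have hκI : ∫⁻ z, κ z < ⊤ := lintegral_min_kernel_lt_top hn h0 h1 B
  have hκm : Measurable κ := by
    have h2 : Measurable fun z : Euc n => ‖z‖ := measurable_norm
    exact ((measurable_const.mul (measurable_const.min h2)).div
      ((h2.pow_const _).mul (h2.pow_const _))).ennreal_ofReal
  set K : Euc n → ℝ≥0∞ := (tsupport Φ).indicator 1 with hK
  have hKm : Measurable K := measurable_one.indicator hc.isCompact.measurableSet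
  have hKI : ∫⁻ x, K x < ⊤ := by
    rw [hK, lintegral_indicator_one hc.isCompact.measurableSet]
    exact hc.isCompact.measure_lt_top
  have hmeas2 : Measurable fun p : Euc n × Euc n => κ (p.1 - p.2) :=
    hκm.comp (measurable_fst.sub measurable_snd)
  have hle : ∀ x y, gagliardoKernel n θ Φ x y ≤ K x * κ (x - y) + K y * κ (x - y) := by
    intro x y
    have hb : gagliardoKernel n θ Φ x y ≤ κ (x - y) := by
      refine ENNReal.ofReal_le_ofReal ?_
      gcongr
      rw [mul_min_of_nonneg _ _ hB, mul_one]
      exact le_min (hbd x y) (hlip x y)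
    by_cases hx : x ∈ tsupport Φ
    · refine hb.trans (le_add_right (le_of_eq ?_))
      simp [hK, hx]
    by_cases hy : y ∈ tsupport Φ
    · refine hb.trans (le_add_left (le_of_eq ?_))
      simp [hK, hy]
    · simp [gagliardoKernel, image_eq_zero_of_notMem_tsupport hx,
        image_eq_zero_of_notMem_tsupport hy]
  have hm1 : Measurable fun p : Euc n × Euc n => K p.1 * κ (p.1 - p.2) :=
    (hKm.comp measurable_fst).mul hmeas2
  have hm2 : Measurable fun p : Euc n × Euc n => K p.2 * κ (p.1 - p.2) :=
    (hKm.comp measurable_snd).mul hmeas2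
  have i1 : ∫⁻ x, ∫⁻ y, K x * κ (x - y) = (∫⁻ x, K x) * ∫⁻ z, κ z := by
    rw [← lintegral_mul_const _ hKm]
    refine lintegral_congr fun x => ?_
    have hmx : Measurable fun y => κ (x - y) := hκm.comp (measurable_const.sub measurable_id)
    rw [lintegral_const_mul _ hmx, lintegral_sub_left_eq_self κ x]
  have i2 : ∫⁻ x, ∫⁻ y, K y * κ (x - y) = (∫⁻ x, K x) * ∫⁻ z, κ z := by
    rw [lintegral_lintegral_swap hm2.aemeasurable, ← lintegral_mul_const _ hKm]
    refine lintegral_congr fun y => ?_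
    have hmy : Measurable fun x => κ (x - y) := hκm.comp (measurable_id.sub measurable_const)
    rw [lintegral_const_mul _ hmy, lintegral_sub_right_eq_self κ y]
  calc ∫⁻ x, ∫⁻ y, gagliardoKernel n θ Φ x y
      ≤ ∫⁻ x, ∫⁻ y, (K x * κ (x - y) + K y * κ (x - y)) :=
        lintegral_mono fun x => lintegral_mono fun y => hle x y
    _ = ∫⁻ x, ((∫⁻ y, K x * κ (x - y)) + ∫⁻ y, K y * κ (x - y)) :=
        lintegral_congr fun x => lintegral_add_left (hm1.comp measurable_prodMk_left) _
    _ = (∫⁻ x, ∫⁻ y, K x * κ (x - y)) + ∫⁻ x, ∫⁻ y, K y * κ (x - y) :=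
        lintegral_add_left hm1.lintegral_prod_right' _
    _ < ⊤ := by
        rw [i1, i2]
        exact ENNReal.add_lt_top.2 ⟨ENNReal.mul_lt_top hKI hκI, ENNReal.mul_lt_top hKI hκI⟩

theorem lintegral_comp_inv_smul {n : ℕ} {ρ : ℝ} (hρ : 0 < ρ) {f : Euc n → ℝ≥0∞}
    (hf : Measurable f) : ∫⁻ x, f (ρ⁻¹ • x) = ENNReal.ofReal (ρ ^ n) * ∫⁻ x, f x := by
  have hmap := Measure.map_addHaar_smul (volume : Measure (Euc n)) (inv_ne_zero hρ.ne')
  rw [← lintegral_map hf (measurable_const_smul ρ⁻¹), hmap, lintegral_smul_measure, smul_eq_mul,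
    finrank_euclideanSpace, Fintype.card_fin, inv_pow, inv_inv, abs_of_pos (by positivity)]

/-- The contribution of a single dilate of `Φ` to the fractional energy. -/
noncomputable def dilateKernel (n : ℕ) (θ : ℝ) {F : Type*} [NormedAddCommGroup F]
    (Φ : Euc n → F) (ρ : ℝ) (x y : Euc n) : ℝ≥0∞ :=
  ENNReal.ofReal (ρ ^ θ * ‖Φ (ρ⁻¹ • x) - Φ (ρ⁻¹ • y)‖ / ‖x - y‖ ^ θ) /
    ENNReal.ofReal (‖x - y‖ ^ (n : ℝ))

theorem measurable_dilateKernel {n : ℕ} {θ : ℝ} {F : Type*} [NormedAddCommGroup F]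
    {Φ : Euc n → F} (hΦ : Continuous Φ) (ρ : ℝ) :
    Measurable (Function.uncurry (dilateKernel n θ Φ ρ)) := by
  have e1 : Measurable fun p : Euc n × Euc n => ‖Φ (ρ⁻¹ • p.1) - Φ (ρ⁻¹ • p.2)‖ :=
    Continuous.measurable (by fun_prop)
  have e2 : Measurable fun p : Euc n × Euc n => ‖p.1 - p.2‖ :=
    (continuous_fst.sub continuous_snd).norm.measurable
  refine Measurable.div ?_ ?_
  · exact ((measurable_const.mul e1).div (e2.pow_const θ)).ennreal_ofReal
  · exact (e2.pow_const (n : ℝ)).ennreal_ofReal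

theorem dilateKernel_le {n : ℕ} {θ : ℝ} {F : Type*} [NormedAddCommGroup F]
    (Φ : Euc n → F) {ρ : ℝ} (hρ : 0 < ρ) (x y : Euc n) :
    dilateKernel n θ Φ ρ x y ≤
    ENNReal.ofReal ((ρ ^ n)⁻¹) * gagliardoKernel n θ Φ (ρ⁻¹ • x) (ρ⁻¹ • y) := by
  rw [dilateKernel]
  rcases eq_or_ne x y with rfl | hxy
  · simp
  have hd : 0 < ‖x - y‖ := norm_pos_iff.2 (sub_ne_zero.2 hxy)
  rw [← ENNReal.ofReal_div_of_pos (by positivity), gagliardoKernel,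
    ← ENNReal.ofReal_mul (by positivity), ← smul_sub, norm_smul,
    Real.norm_of_nonneg (by positivity), Real.mul_rpow (by positivity) hd.le,
    Real.mul_rpow (by positivity) hd.le, Real.inv_rpow hρ.le, Real.inv_rpow hρ.le,
    Real.rpow_natCast ρ n]
  refine le_of_eq (congrArg _ ?_)
  field_simp

theorem lintegral_dilateKernel_le {n : ℕ} {θ : ℝ} {F : Type*} [NormedAddCommGroup F]
    {Φ : Euc n → F} (hΦ : Continuous Φ) {ρ : ℝ} (hρ : 0 < ρ) :
    ∫⁻ x, ∫⁻ y, dilateKernel n θ Φ ρ x y ≤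
    ENNReal.ofReal (ρ ^ n) * ∫⁻ x, ∫⁻ y, gagliardoKernel n θ Φ x y := by
  have hm := measurable_gagliardoKernel (θ := θ) hΦ
  have hmx : ∀ x, Measurable (gagliardoKernel n θ Φ x) := fun x => hm.comp measurable_prodMk_left
  calc _ ≤ ∫⁻ x, ∫⁻ y, ENNReal.ofReal ((ρ ^ n)⁻¹) *
        gagliardoKernel n θ Φ (ρ⁻¹ • x) (ρ⁻¹ • y) :=
        lintegral_mono fun x => lintegral_mono fun y => dilateKernel_le Φ hρ x y
    _ = ∫⁻ x, ∫⁻ y, gagliardoKernel n θ Φ (ρ⁻¹ • x) y := by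
        refine lintegral_congr fun x => ?_
        have hmρ : Measurable fun y => gagliardoKernel n θ Φ (ρ⁻¹ • x) (ρ⁻¹ • y) :=
          (hmx _).comp (measurable_const_smul ρ⁻¹)
        rw [lintegral_const_mul _ hmρ,
          lintegral_comp_inv_smul hρ (hmx _), ← mul_assoc, ← ENNReal.ofReal_mul (by positivity),
          inv_mul_cancel₀ (by positivity), ENNReal.ofReal_one, one_mul]
    _ = _ := lintegral_comp_inv_smul hρ (f := fun x => ∫⁻ y, gagliardoKernel n θ Φ x y)
        hm.lintegral_prod_right'

theorem lintegral_lintegral_sum_const_mul {α β : Type*} [MeasurableSpace α] [MeasurableSpace β]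
    {μ : Measure α} {ν : Measure β} [SFinite ν] {ι : Type*} (t : Finset ι) (c : ι → ℝ≥0∞)
    (Q : ι → α → β → ℝ≥0∞) (hQ : ∀ j, Measurable (Function.uncurry (Q j))) :
    ∫⁻ x, ∫⁻ y, ∑ j ∈ t, c j * Q j x y ∂ν ∂μ = ∑ j ∈ t, c j * ∫⁻ x, ∫⁻ y, Q j x y ∂ν ∂μ := by
  have hx : ∀ j x, Measurable (Q j x) := fun j x => (hQ j).comp measurable_prodMk_left
  have hi : ∀ j, Measurable fun x => ∫⁻ y, Q j x y ∂ν := fun j => (hQ j).lintegral_prod_right'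
  have e : ∀ x, ∫⁻ y, ∑ j ∈ t, c j * Q j x y ∂ν = ∑ j ∈ t, c j * ∫⁻ y, Q j x y ∂ν := by
    intro x
    rw [lintegral_finsetSum _ fun j _ => (hx j x).const_mul _]
    exact Finset.sum_congr rfl fun j _ => lintegral_const_mul _ (hx j x)
  simp_rw [e]
  rw [lintegral_finsetSum _ fun j _ => (hi j).const_mul _]
  exact Finset.sum_congr rfl fun j _ => lintegral_const_mul _ (hi j)

/-- The pointwise Jensen estimate for a finite superposition of dilates of `Φ`. -/
theorem IsYoung.energy_le_sum_dilateKernel {A : ℝ → ℝ≥0∞} (hA : IsYoung A) {n : ℕ} {θ : ℝ}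
    {ι : Type*} [Fintype ι] (Φ : Euc n → EuclideanSpace ℝ ι) (t : Finset ℕ) (ρ g : ℕ → ℝ)
    (hρ : ∀ j, 0 < ρ j) (hg : ∀ j, 0 ≤ g j) {lam : ℝ} (hlam : 0 < lam) (x y : Euc n)
    (hsum : ∑ j ∈ t, ρ j ^ θ * ‖Φ ((ρ j)⁻¹ • x) - Φ ((ρ j)⁻¹ • y)‖ / ‖x - y‖ ^ θ ≤ lam) :
    A (Real.sqrt (∑ i, ((∑ j ∈ t, g j * ρ j ^ θ * Φ ((ρ j)⁻¹ • x) i) / lam -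
        (∑ j ∈ t, g j * ρ j ^ θ * Φ ((ρ j)⁻¹ • y) i) / lam) ^ 2) / ‖x - y‖ ^ θ) /
      ENNReal.ofReal (‖x - y‖ ^ (n : ℝ)) ≤
    ∑ j ∈ t, (A (g j) / ENNReal.ofReal lam) * dilateKernel n θ Φ (ρ j) x y := by
  set K : ℕ → ℝ := fun j =>
    ρ j ^ θ * ‖Φ ((ρ j)⁻¹ • x) - Φ ((ρ j)⁻¹ • y)‖ / ‖x - y‖ ^ θ with hK
  have hρθ : ∀ j, 0 ≤ ρ j ^ θ := fun j => Real.rpow_nonneg (hρ j).le θ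
  have hK0 : ∀ j, 0 ≤ K j := fun j =>
    div_nonneg (mul_nonneg (hρθ j) (norm_nonneg _)) (Real.rpow_nonneg (norm_nonneg _) θ)
  have hnorm : Real.sqrt (∑ i, ((∑ j ∈ t, g j * ρ j ^ θ * Φ ((ρ j)⁻¹ • x) i) / lam -
        (∑ j ∈ t, g j * ρ j ^ θ * Φ ((ρ j)⁻¹ • y) i) / lam) ^ 2) =
      ‖∑ j ∈ t, (g j * ρ j ^ θ / lam) • (Φ ((ρ j)⁻¹ • x) - Φ ((ρ j)⁻¹ • y))‖ := by
    rw [EuclideanSpace.norm_eq]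
    congr 1
    refine Finset.sum_congr rfl fun i _ => ?_
    rw [Real.norm_eq_abs, sq_abs, ← sub_div, ← Finset.sum_sub_distrib, Finset.sum_div]
    congr 1
    simp only [WithLp.ofLp_sum, Finset.sum_apply, PiLp.smul_apply, PiLp.sub_apply, smul_eq_mul]
    refine Finset.sum_congr rfl fun j _ => ?_
    ring
  have hle : Real.sqrt (∑ i, ((∑ j ∈ t, g j * ρ j ^ θ * Φ ((ρ j)⁻¹ • x) i) / lam -
        (∑ j ∈ t, g j * ρ j ^ θ * Φ ((ρ j)⁻¹ • y) i) / lam) ^ 2) / ‖x - y‖ ^ θ ≤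
      ∑ j ∈ t, K j / lam * g j := by
    rw [hnorm]
    calc _ ≤ (∑ j ∈ t, ‖(g j * ρ j ^ θ / lam) •
          (Φ ((ρ j)⁻¹ • x) - Φ ((ρ j)⁻¹ • y))‖) / ‖x - y‖ ^ θ :=
          div_le_div_of_nonneg_right (norm_sum_le _ _) (Real.rpow_nonneg (norm_nonneg _) θ)
      _ = _ := by
          rw [Finset.sum_div]
          refine Finset.sum_congr rfl fun j _ => ?_
          have : 0 ≤ g j * ρ j ^ θ / lam := div_nonneg (mul_nonneg (hg j) (hρθ j)) hlam.le
          rw [norm_smul, Real.norm_of_nonneg this]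
          simp only [hK]
          ring
  have hw : ∑ j ∈ t, K j / lam ≤ 1 := by
    rw [← Finset.sum_div, div_le_one hlam]
    exact hsum
  have hJ := (hA.mono (by positivity) hle).trans
    (hA.sum_le t (fun j => K j / lam) g (fun j => div_nonneg (hK0 j) hlam.le) hg hw)
  refine (ENNReal.div_le_div_right hJ _).trans (le_of_eq ?_)
  simp only [div_eq_mul_inv, Finset.sum_mul, dilateKernel]
  refine Finset.sum_congr rfl fun j _ => ?_
  rw [ENNReal.ofReal_mul (hK0 j), ENNReal.ofReal_inv_of_pos hlam]
  simp only [hK, div_eq_mul_inv]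
  ring

theorem fracSem_dyadic_le {n : ℕ} (hn : 0 < n) {θ : ℝ} (h0 : 0 < θ) (h1 : θ < 1) {ι : Type}
    [Fintype ι] (Φ : Euc n → EuclideanSpace ℝ ι) (hΦ : Continuous Φ) (B : ℝ) (hB : 0 ≤ B)
    (hc : HasCompactSupport Φ)
    (hbd : ∀ x y, ‖Φ x - Φ y‖ ≤ B) (hlip : ∀ x y, ‖Φ x - Φ y‖ ≤ B * ‖x - y‖) :
    ∃ M : ℝ, 0 < M ∧ ∀ A : ℝ → ℝ≥0∞, IsYoung A → ∀ R : ℝ, 0 < R → ∀ (N : ℕ) (g : ℕ → ℝ),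
      (∀ j, 0 ≤ g j) → (∀ j, A (g j) ≠ ⊤) →
      fracSem n θ A (fun x i => ∑ j ∈ Finset.range N,
          g j * (2 ^ j * R) ^ θ * Φ ((2 ^ j * R)⁻¹ • x) i) ≤
        ENNReal.ofReal (M * (1 + ∑ j ∈ Finset.range N, (2 ^ j * R) ^ n * (A (g j)).toReal)) := by
  obtain ⟨M, hM, hMs⟩ := exists_sum_dilates_le h0 h1 Φ B hB hbd hlip
  have hCfin := lintegral_gagliardoKernel_lt_top hn h0 h1 Φ B hB hc hbd hlip
  set C : ℝ≥0∞ := ∫⁻ x, ∫⁻ y, gagliardoKernel n θ Φ x y with hC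
  refine ⟨M + C.toReal, by positivity, fun A hA R hR N g hg hgA => ?_⟩
  have hρ : ∀ j : ℕ, 0 < 2 ^ j * R := fun j => by positivity
  set S : ℝ := ∑ j ∈ Finset.range N, (2 ^ j * R) ^ n * (A (g j)).toReal with hS
  have hS0 : 0 ≤ S := Finset.sum_nonneg fun j _ => by positivity
  set lam : ℝ := (M + C.toReal) * (1 + S) with hlam
  have hC0 : 0 ≤ C.toReal := ENNReal.toReal_nonneg
  have hlam0 : 0 < lam := by positivity
  have hlamM : M ≤ lam := by rw [hlam]; nlinarith [mul_nonneg hM.le hS0, mul_nonneg hC0 hS0]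
  have hlamC : C.toReal * S ≤ lam := by
    rw [hlam]; nlinarith [mul_nonneg hM.le hS0, mul_nonneg hC0 hS0]
  refine sInf_le ⟨lam, ⟨hlam0, ?_⟩, rfl⟩
  calc Jfun n θ A (fun x i => (∑ j ∈ Finset.range N,
          g j * (2 ^ j * R) ^ θ * Φ ((2 ^ j * R)⁻¹ • x) i) / lam)
      ≤ ∫⁻ x, ∫⁻ y, ∑ j ∈ Finset.range N,
          (A (g j) / ENNReal.ofReal lam) * dilateKernel n θ Φ (2 ^ j * R) x y :=
        lintegral_mono fun x => lintegral_mono fun y =>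
          hA.energy_le_sum_dilateKernel Φ (Finset.range N) (fun j => 2 ^ j * R) g hρ hg hlam0 x y
            ((hMs R hR N x y).trans hlamM)
    _ = ∑ j ∈ Finset.range N, (A (g j) / ENNReal.ofReal lam) *
          ∫⁻ x, ∫⁻ y, dilateKernel n θ Φ (2 ^ j * R) x y :=
        lintegral_lintegral_sum_const_mul _ _ _ fun j => measurable_dilateKernel hΦ _
    _ ≤ ∑ j ∈ Finset.range N, ENNReal.ofReal ((2 ^ j * R) ^ n * (A (g j)).toReal *
          C.toReal / lam) := by
        refine Finset.sum_le_sum fun j _ => ?_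
        refine (mul_le_mul_right (lintegral_dilateKernel_le hΦ (hρ j)) _).trans (le_of_eq ?_)
        rw [← hC, ENNReal.ofReal_div_of_pos hlam0,
          ENNReal.ofReal_mul (p := (2 ^ j * R) ^ n * (A (g j)).toReal) (by positivity),
          ENNReal.ofReal_mul (p := (2 ^ j * R) ^ n) (by positivity), ENNReal.ofReal_toReal (hgA j),
          ENNReal.ofReal_toReal hCfin.ne]
        simp only [div_eq_mul_inv]
        ring
    _ = ENNReal.ofReal (S * C.toReal / lam) := by
        rw [hS, Finset.sum_mul, Finset.sum_div, ENNReal.ofReal_sum_of_nonneg]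
        exact fun j _ => by positivity
    _ ≤ 1 := by
        rw [ENNReal.ofReal_le_one, div_le_one hlam0, mul_comm]
        exact hlamC

theorem sum_choose_eval_eq {k : ℕ} (b : ℝ) {W : Polynomial ℝ} (hW : W.natDegree ≤ k) :
    ∑ j ∈ Finset.range (k + 2), ((-1 : ℝ) ^ (k + 1 - j) * ((k + 1).choose j : ℝ)) *
      (b * (j : ℝ) ^ (k + 1) + W.eval (j : ℝ)) = b * ((k + 1).factorial : ℝ) := by
  have e1 := congrFun (fwdDiff_iter_eq_factorial (R := ℝ) (n := k + 1)) 0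
  have e2 := congrFun (Polynomial.fwdDiff_iter_eq_zero_of_degree_lt
    (P := W) (n := k + 1) (by omega)) 0
  rw [fwdDiff_iter_eq_sum_shift] at e1 e2
  simp only [zero_add, nsmul_eq_mul, mul_one, zsmul_eq_mul, Int.cast_mul, Int.cast_pow,
    Int.cast_neg, Int.cast_one, Int.cast_natCast, Pi.zero_apply, Pi.natCast_apply] at e1 e2
  simp only [mul_add, Finset.sum_add_distrib]
  rw [e2, add_zero, ← e1, Finset.mul_sum]
  refine Finset.sum_congr rfl fun j _ => ?_
  ring

/-- Along a coordinate line, a function `a x_i^{k+1} - P` with `deg P ≤ k` is a polynomial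
with prescribed top coefficient. -/
theorem exists_polynomial_line {n k : ℕ} (i₀ : Fin n) (P : MvPolynomial (Fin n) ℝ)
    (hP : P.totalDegree ≤ k) (a τ : ℝ) (x : Euc n) :
    ∃ W : Polynomial ℝ, W.natDegree ≤ k ∧ ∀ t : ℝ,
      a * ((x + (t * τ) • EuclideanSpace.single i₀ (1 : ℝ) : Euc n) i₀) ^ (k + 1) -
        MvPolynomial.eval
          (fun i => (x + (t * τ) • EuclideanSpace.single i₀ (1 : ℝ) : Euc n) i) P =
      a * τ ^ (k + 1) * t ^ (k + 1) + W.eval t := by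
  classical
  set Y : Polynomial ℝ := Polynomial.C τ * Polynomial.X with hY
  set Z : Polynomial ℝ := Polynomial.C (x i₀) + Y with hZ
  set ℓ : Fin n → Polynomial ℝ :=
    fun i => Polynomial.C (x i) + if i = i₀ then Y else 0 with hℓ
  have hYd : Y.natDegree ≤ 1 := (Polynomial.natDegree_C_mul_le _ _).trans Polynomial.natDegree_X_le
  have hZd : Z.natDegree ≤ 1 := Polynomial.natDegree_add_le_of_degree_le (by simp) hYd
  have hℓd : ∀ i, (ℓ i).natDegree ≤ 1 := by
    intro i
    refine Polynomial.natDegree_add_le_of_degree_le (by simp) ?_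
    split_ifs
    · exact hYd
    · simp
  refine ⟨Polynomial.C a * ((∑ i ∈ Finset.range (k + 1), Z ^ i * Y ^ (k + 1 - 1 - i)) *
    Polynomial.C (x i₀)) - MvPolynomial.aeval ℓ P, ?_, fun t => ?_⟩
  · refine (Polynomial.natDegree_sub_le _ _).trans (max_le ?_ ?_)
    · refine (Polynomial.natDegree_C_mul_le _ _).trans
        ((Polynomial.natDegree_mul_C_le _ _).trans ?_)
      refine Polynomial.natDegree_sum_le_of_forall_le _ _ fun i hi => ?_
      have hi' := Finset.mem_range.1 hi
      calc (Z ^ i * Y ^ (k + 1 - 1 - i)).natDegree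
          ≤ i * 1 + (k + 1 - 1 - i) * 1 := by
            refine Polynomial.natDegree_mul_le.trans (add_le_add ?_ ?_)
            · exact Polynomial.natDegree_pow_le_of_le i hZd
            · exact Polynomial.natDegree_pow_le_of_le _ hYd
        _ ≤ k := by omega
    · exact (MvPolynomial.aeval_natDegree_le P hP ℓ hℓd).trans (by simp)
  · have hsub : Z - Y = Polynomial.C (x i₀) := by rw [hZ]; ring
    have hev : Polynomial.eval t (MvPolynomial.aeval ℓ P) = MvPolynomial.eval
        (fun i => (x + (t * τ) • EuclideanSpace.single i₀ (1 : ℝ) : Euc n) i) P := by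
      rw [← Polynomial.coe_evalRingHom, MvPolynomial.aeval_def, MvPolynomial.hom_eval₂,
        MvPolynomial.eval, MvPolynomial.coe_eval₂Hom]
      congr 1
      · exact RingHom.ext fun z => by simp
      · funext i
        by_cases hi : i = i₀
        · subst hi
          simp only [hℓ, hY, if_true]
          simp
          ring
        · simp [hℓ, hi]
    rw [← hsub, geom_sum₂_mul, Polynomial.eval_sub, hev]
    simp [hZ, hY, mul_pow]
    ring

theorem osc_lower_pointwise {n k : ℕ} (i₀ : Fin n) (P : MvPolynomial (Fin n) ℝ)
    (hP : P.totalDegree ≤ k) (a τ : ℝ) (ha : 0 ≤ a) (hτ : 0 ≤ τ) (x : Euc n) :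
    a * τ ^ (k + 1) ≤ ∑ j ∈ Finset.range (k + 2), ((k + 1).choose j : ℝ) *
      |a * ((x + ((j : ℝ) * τ) • EuclideanSpace.single i₀ (1 : ℝ) : Euc n) i₀) ^ (k + 1) -
        MvPolynomial.eval
          (fun i => (x + ((j : ℝ) * τ) • EuclideanSpace.single i₀ (1 : ℝ) : Euc n) i) P| := by
  obtain ⟨W, hW, hWe⟩ := exists_polynomial_line i₀ P hP a τ x
  have h := sum_choose_eval_eq (a * τ ^ (k + 1)) hW
  have hb : 0 ≤ a * τ ^ (k + 1) := by positivity
  have hf : (1 : ℝ) ≤ ((k + 1).factorial : ℝ) := by exact_mod_cast (k + 1).factorial_pos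
  calc a * τ ^ (k + 1) ≤ a * τ ^ (k + 1) * ((k + 1).factorial : ℝ) := le_mul_of_one_le_right hb hf
    _ ≤ |∑ j ∈ Finset.range (k + 2), ((-1 : ℝ) ^ (k + 1 - j) * ((k + 1).choose j : ℝ)) *
      (a * τ ^ (k + 1) * (j : ℝ) ^ (k + 1) + W.eval (j : ℝ))| := by
        rw [h]; exact le_abs_self _
    _ ≤ _ := by
        refine (Finset.abs_sum_le_sum_abs _ _).trans (le_of_eq ?_)
        refine Finset.sum_congr rfl fun j _ => ?_
        rw [hWe, abs_mul, abs_mul, abs_pow, abs_neg, abs_one, one_pow, one_mul, Nat.abs_cast]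

/-- A monomial `a y_i^{k+1}` stays away from polynomials of degree at most `k` in the mean over
balls centred at the origin. -/
theorem exists_le_average_sub_polynomial {n : ℕ} (k : ℕ) (i₀ : Fin n) :
    ∃ c₀ : ℝ, 0 < c₀ ∧ ∀ R : ℝ, 0 < R → ∀ a : ℝ, 0 ≤ a → ∀ P : MvPolynomial (Fin n) ℝ,
      P.totalDegree ≤ k → c₀ * a * R ^ (k + 1) ≤
        ⨍ y in ball (0 : Euc n) R, |a * y i₀ ^ (k + 1) - MvPolynomial.eval (fun i => y i) P| := by
  set δ : ℝ := (2 * ((k : ℝ) + 2))⁻¹ with hδ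
  have hδ0 : 0 < δ := by positivity
  refine ⟨δ ^ (k + 1) * ((2 : ℝ)⁻¹ ^ n) / 2 ^ (k + 1), by positivity, fun R hR a ha P hP => ?_⟩
  set e : Euc n := EuclideanSpace.single i₀ (1 : ℝ) with he
  set f : Euc n → ℝ := fun y => |a * y i₀ ^ (k + 1) - MvPolynomial.eval (fun i => y i) P| with hf
  have hfc : Continuous f := by
    have h1 : Continuous fun y : Euc n => MvPolynomial.eval (fun i => y i) P :=
      (MvPolynomial.continuous_eval P).comp (by fun_prop)
    fun_prop
  have hf0 : ∀ y, 0 ≤ f y := fun y => abs_nonneg _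
  have hfi : ∀ (z : Euc n) (r : ℝ), IntegrableOn f (ball z r) := fun z r =>
    (hfc.continuousOn.integrableOn_compact (isCompact_closedBall z r)).mono_set
      ball_subset_closedBall
  have hshift : ∀ j ∈ Finset.range (k + 2),
      ∫ x in ball (0 : Euc n) (R / 2), f (x + ((j : ℝ) * (δ * R)) • e) ≤
        ∫ x in ball (0 : Euc n) R, f x := by
    intro j hj
    have hj' : (j : ℝ) ≤ k + 1 := by
      exact_mod_cast Nat.lt_succ_iff.1 (Finset.mem_range.1 hj)
    set z : Euc n := ((j : ℝ) * (δ * R)) • e with hz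
    have hzn : ‖z‖ ≤ R / 2 := by
      rw [hz, norm_smul, he, PiLp.norm_single, norm_one, mul_one,
        Real.norm_of_nonneg (by positivity), hδ]
      have : (j : ℝ) * (2 * ((k : ℝ) + 2))⁻¹ ≤ 1 / 2 := by
        rw [← div_eq_mul_inv, div_le_div_iff₀ (by positivity) (by norm_num)]
        linarith
      nlinarith
    have hpre : (fun x => x + z) ⁻¹' ball z (R / 2) = ball (0 : Euc n) (R / 2) := by
      ext x; simp [mem_ball, dist_eq_norm]
    rw [← hpre, (measurePreserving_add_right volume z).setIntegral_preimage_emb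
      (measurableEmbedding_addRight z)]
    refine setIntegral_mono_set (hfi _ _) (Filter.Eventually.of_forall hf0)
      (Filter.Eventually.of_forall ?_)
    refine ball_subset_ball' ?_
    rw [dist_zero_right]; linarith
  have hvol : (volume.real (ball (0 : Euc n) (R / 2))) =
      (2 : ℝ)⁻¹ ^ n * volume.real (ball (0 : Euc n) R) := by
    rw [measureReal_def, measureReal_def, Measure.addHaar_ball_of_pos _ _ hR,
      Measure.addHaar_ball_of_pos _ _ (half_pos hR), ENNReal.toReal_mul, ENNReal.toReal_mul,
      ENNReal.toReal_ofReal (by positivity), ENNReal.toReal_ofReal (by positivity),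
      finrank_euclideanSpace, Fintype.card_fin, div_eq_inv_mul, mul_pow]
    ring
  have hV : 0 < volume.real (ball (0 : Euc n) R) :=
    ENNReal.toReal_pos (measure_ball_pos _ _ hR).ne' measure_ball_lt_top.ne
  have hmain : a * (δ * R) ^ (k + 1) * volume.real (ball (0 : Euc n) (R / 2)) ≤
      2 ^ (k + 1) * ∫ x in ball (0 : Euc n) R, f x := by
    have hint : ∀ j ∈ Finset.range (k + 2), IntegrableOn
        (fun x => ((k + 1).choose j : ℝ) * f (x + ((j : ℝ) * (δ * R)) • e))
        (ball (0 : Euc n) (R / 2)) := fun j _ => by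
      have h1 : Continuous fun x => ((k + 1).choose j : ℝ) * f (x + ((j : ℝ) * (δ * R)) • e) := by
        fun_prop
      exact (h1.continuousOn.integrableOn_compact (isCompact_closedBall 0 (R / 2))).mono_set
        ball_subset_closedBall
    calc a * (δ * R) ^ (k + 1) * volume.real (ball (0 : Euc n) (R / 2))
        = ∫ _ in ball (0 : Euc n) (R / 2), a * (δ * R) ^ (k + 1) := by
          rw [setIntegral_const, smul_eq_mul, mul_comm]
      _ ≤ ∫ x in ball (0 : Euc n) (R / 2), ∑ j ∈ Finset.range (k + 2),
            ((k + 1).choose j : ℝ) * f (x + ((j : ℝ) * (δ * R)) • e) := by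
          refine integral_mono ?_ (integrable_finsetSum _ hint)
            fun x => osc_lower_pointwise i₀ P hP a (δ * R) ha (by positivity) x
          exact integrableOn_const (hs := measure_ball_lt_top.ne)
      _ = ∑ j ∈ Finset.range (k + 2), ((k + 1).choose j : ℝ) *
            ∫ x in ball (0 : Euc n) (R / 2), f (x + ((j : ℝ) * (δ * R)) • e) := by
          rw [integral_finsetSum _ hint]
          simp only [integral_const_mul]
      _ ≤ ∑ j ∈ Finset.range (k + 2), ((k + 1).choose j : ℝ) *
            ∫ x in ball (0 : Euc n) R, f x :=
          Finset.sum_le_sum fun j hj =>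
            mul_le_mul_of_nonneg_left (hshift j hj) (Nat.cast_nonneg _)
      _ = _ := by
          rw [← Finset.sum_mul]
          congr 1
          exact_mod_cast Nat.sum_range_choose (k + 1)
  rw [setAverage_eq, smul_eq_mul, inv_mul_eq_div, le_div_iff₀ hV]
  rw [hvol] at hmain
  have h2 : (0 : ℝ) < 2 ^ (k + 1) := by positivity
  calc _ = (a * (δ * R) ^ (k + 1) * (2⁻¹ ^ n * volume.real (ball (0 : Euc n) R))) / 2 ^ (k + 1) := by
        ring
    _ ≤ _ := by rw [div_le_iff₀ h2]; linarith

theorem exists_truncated_monomial {n : ℕ} (k : ℕ) (i₀ : Fin n) :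
    ∃ Θ : Euc n → ℝ, ContDiff ℝ (⊤ : ℕ∞) Θ ∧ HasCompactSupport Θ ∧
      ∀ x ∈ ball (0 : Euc n) 1, Θ x = x i₀ ^ (k + 1) := by
  let b : ContDiffBump (0 : Euc n) := ⟨1, 2, one_pos, one_lt_two⟩
  refine ⟨fun x => b x * x i₀ ^ (k + 1), b.contDiff.mul (by fun_prop),
    b.hasCompactSupport.mul_right, fun x hx => ?_⟩
  have : b x = 1 := b.one_of_mem_closedBall (ball_subset_closedBall hx)
  simp [this]

/-- A finite superposition of rescaled copies of `Θ`, homogeneous of order `s`. -/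
noncomputable def superposition {n : ℕ} (Θ : Euc n → ℝ) (s R : ℝ) (g : ℕ → ℝ) (N : ℕ)
    (x : Euc n) : ℝ :=
  ∑ j ∈ Finset.range N, (g j * (2 ^ j * R) ^ s) • Θ ((2 ^ j * R)⁻¹ • x)

theorem contDiff_superposition {n : ℕ} {Θ : Euc n → ℝ} (hΘ : ContDiff ℝ (⊤ : ℕ∞) Θ) (s R : ℝ)
    (g : ℕ → ℝ) (N : ℕ) : ContDiff ℝ (⊤ : ℕ∞) (superposition Θ s R g N) :=
  ContDiff.sum fun j _ => (hΘ.comp (contDiff_const_smul (2 ^ j * R)⁻¹)).const_smul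
    (g j * (2 ^ j * R) ^ s)

theorem hasCompactSupport_superposition {n : ℕ} {Θ : Euc n → ℝ} (hc : HasCompactSupport Θ)
    (s : ℝ) {R : ℝ} (hR : 0 < R) (g : ℕ → ℝ) (N : ℕ) :
    HasCompactSupport (superposition Θ s R g N) := by
  induction N with
  | zero =>
    have : superposition Θ s R g 0 = 0 := by funext x; simp [superposition]
    rw [this]; exact HasCompactSupport.zero
  | succ N ih =>
    have : superposition Θ s R g (N + 1) = superposition Θ s R g N +
        fun x => (g N * (2 ^ N * R) ^ s) • Θ ((2 ^ N * R)⁻¹ • x) := by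
      funext x; simp [superposition, Finset.sum_range_succ]
    rw [this]
    refine ih.add (HasCompactSupport.smul_left (f := fun _ => g N * (2 ^ N * R) ^ s) ?_)
    exact hc.comp_smul (inv_ne_zero (by positivity))

theorem derivCoord_superposition {n : ℕ} {Θ : Euc n → ℝ} (hΘ : ContDiff ℝ (⊤ : ℕ∞) Θ) (s : ℝ)
    {R : ℝ} (hR : 0 < R) (g : ℕ → ℝ) (N m : ℕ) (x : Euc n) (dirs : Fin m → Fin n) :
    derivCoord (superposition Θ s R g N) m x dirs = ∑ j ∈ Finset.range N,
      g j * (2 ^ j * R) ^ (s - m) * derivCoord Θ m ((2 ^ j * R)⁻¹ • x) dirs := by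
  have hd : ∀ j : ℕ, ContDiff ℝ m fun y : Euc n => Θ ((2 ^ j * R)⁻¹ • y) := fun j =>
    (hΘ.of_le (by exact_mod_cast le_top)).comp (contDiff_const_smul (2 ^ j * R)⁻¹)
  have e : superposition Θ s R g N = fun x => ∑ j ∈ Finset.range N,
      (g j * (2 ^ j * R) ^ s) • Θ ((2 ^ j * R)⁻¹ • x) := rfl
  rw [derivCoord, e, iteratedFDeriv_fun_sum_apply fun j _ => ((hd j).const_smul _).contDiffAt,
    sum_apply]
  refine Finset.sum_congr rfl fun j _ => ?_
  have hρ : (0 : ℝ) < 2 ^ j * R := by positivity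
  rw [iteratedFDeriv_const_smul_apply' (hd j).contDiffAt,
    congrFun (iteratedFDeriv_comp_const_smul (f := Θ) (i := m) (2 ^ j * R)⁻¹
      (hΘ.of_le (by exact_mod_cast le_top))) x]
  rw [derivCoord, Real.rpow_sub hρ, Real.rpow_natCast]
  simp only [smul_apply, smul_eq_mul, inv_pow]
  field_simp

theorem superposition_eq_of_mem_ball {n k : ℕ} {i₀ : Fin n} {Θ : Euc n → ℝ}
    (hΘ : ∀ x ∈ ball (0 : Euc n) 1, Θ x = x i₀ ^ (k + 1)) (s : ℝ)
    {R : ℝ} (hR : 0 < R) (g : ℕ → ℝ) (N : ℕ) {x : Euc n} (hx : x ∈ ball (0 : Euc n) R) :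
    superposition Θ s R g N x =
      (∑ j ∈ Finset.range N, g j * (2 ^ j * R) ^ (s - (k + 1))) * x i₀ ^ (k + 1) := by
  rw [superposition, Finset.sum_mul]
  refine Finset.sum_congr rfl fun j _ => ?_
  have hρ : (0 : ℝ) < 2 ^ j * R := by positivity
  have hRρ : R ≤ 2 ^ j * R := le_mul_of_one_le_left hR.le (one_le_pow₀ one_le_two)
  rw [hΘ]
  · have : s - ((k : ℝ) + 1) = s - ((k + 1 : ℕ) : ℝ) := by push_cast; ring
    rw [this, Real.rpow_sub hρ, Real.rpow_natCast]
    simp only [PiLp.smul_apply, smul_eq_mul, mul_pow, inv_pow]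
    field_simp
  · rw [mem_ball_zero_iff] at hx ⊢
    rw [norm_smul, Real.norm_of_nonneg (by positivity), inv_mul_lt_one₀ hρ]
    exact hx.trans_le hRρ

theorem exists_bound_lipschitz_bound {n m : ℕ} {Θ : Euc n → ℝ} (hΘ : ContDiff ℝ (⊤ : ℕ∞) Θ)
    (hc : HasCompactSupport Θ) :
    ∃ Φ : Euc n → EuclideanSpace ℝ (Fin m → Fin n), (∀ x d, Φ x d = derivCoord Θ m x d) ∧
      Continuous Φ ∧ HasCompactSupport Φ ∧ ∃ B : ℝ, 0 ≤ B ∧ (∀ x y, ‖Φ x - Φ y‖ ≤ B) ∧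
        ∀ x y, ‖Φ x - Φ y‖ ≤ B * ‖x - y‖ := by
  set Φ : Euc n → EuclideanSpace ℝ (Fin m → Fin n) := fun x => WithLp.toLp 2 (derivCoord Θ m x)
    with hΦ
  have hΦd : ContDiff ℝ (⊤ : ℕ∞) Φ := by
    rw [contDiff_euclidean]
    exact fun d => contDiff_derivCoord hΘ m d
  have hΦc : HasCompactSupport Φ := by
    refine HasCompactSupport.intro hc fun x hx => ?_
    ext d
    exact derivCoord_eq_zero_of_notMem hx d
  obtain ⟨C, hC⟩ := hΦd.continuous.bounded_above_of_compact_support hΦc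
  obtain ⟨L, hL⟩ := hΦd.lipschitzWith_of_hasCompactSupport hΦc (by simp)
  have hC0 : 0 ≤ C := (norm_nonneg _).trans (hC 0)
  refine ⟨Φ, fun x d => rfl, hΦd.continuous, hΦc, 2 * C + L, by positivity, fun x y => ?_,
    fun x y => ?_⟩
  · have := (norm_sub_le (Φ x) (Φ y)).trans (add_le_add (hC x) (hC y))
    have := L.coe_nonneg
    linarith
  · refine (hL.norm_sub_le x y).trans ?_
    gcongr
    linarith

/-- Testing the embedding against dyadic superpositions. -/
theorem exists_dyadic_le {n : ℕ} (hn : 0 < n) {s : ℝ} (hs1 : 1 < s) (hs2 : ∀ m : ℕ, s ≠ (m : ℝ))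
    (k : ℕ) {A : ℝ → ℝ≥0∞} (hA : IsYoung A)
    {φ : ℝ → ℝ} (hφ : Admissible φ) {c : ℝ} (hc : 0 < c)
    (hemb : ∀ (u : Euc n → ℝ) (D : (h : ℕ) → Euc n → (Fin h → Fin n) → ℝ),
      HasWeakDerivs n ⌊s⌋₊ u D → DecayFrom n (k + 1) ⌊s⌋₊ D →
      fracSem n (s - (⌊s⌋₊ : ℝ)) A (D ⌊s⌋₊) < ⊤ →
      campSemK n k φ u D ≤ ENNReal.ofReal c * fracSem n (s - (⌊s⌋₊ : ℝ)) A (D ⌊s⌋₊)) :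
    ∃ M : ℝ, 0 < M ∧ ∀ R : ℝ, 0 < R → ∀ (N : ℕ) (g : ℕ → ℝ), (∀ j, 0 ≤ g j) →
      (∀ j, A (g j) ≠ ⊤) →
      R ^ (k + 1) * ∑ j ∈ Finset.range N, g j * (2 ^ j * R) ^ (s - (k + 1)) ≤
        M * (φ ((volume (ball (0 : Euc n) R)).toReal ^ ((n : ℝ)⁻¹)) *
          (volume (ball (0 : Euc n) R)).toReal ^ ((k : ℝ) / (n : ℝ))) *
        (1 + ∑ j ∈ Finset.range N, (2 ^ j * R) ^ n * (A (g j)).toReal) := by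
  have hθ0 : 0 < s - (⌊s⌋₊ : ℝ) :=
    sub_pos.2 (lt_of_le_of_ne (Nat.floor_le (by linarith)) (hs2 _).symm)
  have hθ1 : s - (⌊s⌋₊ : ℝ) < 1 := by linarith [Nat.lt_floor_add_one s]
  obtain ⟨Θ, hΘ, hΘc, hΘe⟩ := exists_truncated_monomial k (⟨0, hn⟩ : Fin n)
  obtain ⟨Φ, hΦe, hΦ, hΦc, B, hB, hbd, hlip⟩ :=
    exists_bound_lipschitz_bound (m := ⌊s⌋₊) hΘ hΘc
  obtain ⟨M, hM, hMle⟩ := fracSem_dyadic_le hn hθ0 hθ1 Φ hΦ B hB hΦc hbd hlip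
  obtain ⟨c₀, hc₀, hlow⟩ := exists_le_average_sub_polynomial k (⟨0, hn⟩ : Fin n)
  refine ⟨c * M / c₀, by positivity, fun R hR N g hg hgA => ?_⟩
  set V : ℝ := (volume (ball (0 : Euc n) R)).toReal with hV
  have hVpos : 0 < V := ENNReal.toReal_pos (measure_ball_pos _ _ hR).ne' measure_ball_lt_top.ne
  have hW : 0 < φ (V ^ ((n : ℝ)⁻¹)) * V ^ ((k : ℝ) / (n : ℝ)) :=
    mul_pos (hφ.1 _ (by positivity)) (by positivity)
  set W : ℝ := φ (V ^ ((n : ℝ)⁻¹)) * V ^ ((k : ℝ) / (n : ℝ)) with hWd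
  set a : ℝ := ∑ j ∈ Finset.range N, g j * (2 ^ j * R) ^ (s - (k + 1)) with ha
  have ha0 : 0 ≤ a := Finset.sum_nonneg fun j _ => mul_nonneg (hg j) (by positivity)
  set T : ℝ := 1 + ∑ j ∈ Finset.range N, (2 ^ j * R) ^ n * (A (g j)).toReal with hT
  have hT0 : 0 ≤ T := add_nonneg zero_le_one (Finset.sum_nonneg fun j _ => by positivity)
  set u := superposition Θ s R g N with hu
  have hfs : fracSem n (s - (⌊s⌋₊ : ℝ)) A (derivCoord u ⌊s⌋₊) ≤ ENNReal.ofReal (M * T) := by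
    convert hMle A hA R hR N g hg hgA using 3 with x
    funext d
    rw [hu, derivCoord_superposition hΘ s hR]
    simp only [hΦe]
  have h1 := hemb u (derivCoord u) (hasWeakDerivs_derivCoord _ (contDiff_superposition hΘ s R g N))
    (decayFrom_derivCoord _ _ (hasCompactSupport_superposition hΘc s hR g N))
    (hfs.trans_lt ENNReal.ofReal_lt_top)
  have h2 : ENNReal.ofReal (W⁻¹ * (c₀ * a * R ^ (k + 1))) ≤ campSemK n k φ u (derivCoord u) := by
    refine le_trans ?_ (le_iSup_of_le 0 (le_iSup_of_le R (le_iSup_of_le hR le_rfl)))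
    refine le_iInf fun P => le_iInf fun hP => ENNReal.ofReal_le_ofReal ?_
    refine mul_le_mul_of_nonneg_left ((hlow R hR a ha0 P hP.1).trans (le_of_eq ?_)) (by positivity)
    refine setAverage_congr_fun measurableSet_ball (Filter.Eventually.of_forall fun y hy => ?_)
    simp only [hu, superposition_eq_of_mem_ball hΘe s hR g N hy, ha]
  have h3 := h2.trans (h1.trans (mul_le_mul_right hfs _))
  rw [← ENNReal.ofReal_mul hc.le, ENNReal.ofReal_le_ofReal_iff (by positivity),
    inv_mul_le_iff₀ hW] at h3
  rw [div_mul_eq_mul_div, div_mul_eq_mul_div, le_div_iff₀ hc₀]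
  linarith

theorem add_sum_iSup_le {α ι : Type*} [Nonempty α] (f : ι → α → ℝ≥0∞) (t : Finset ι)
    (b C : ℝ≥0∞) (h : ∀ g : ι → α, b + ∑ i ∈ t, f i (g i) ≤ C) :
    b + ∑ i ∈ t, ⨆ a, f i a ≤ C := by
  classical
  induction t using Finset.induction_on generalizing b with
  | empty => simpa using h fun _ => Classical.arbitrary α
  | insert i t hi ih =>
    rw [Finset.sum_insert hi, ENNReal.iSup_add, ENNReal.add_iSup]
    refine iSup_le fun a => ?_
    rw [← add_assoc]
    refine ih _ fun g => ?_
    have := h (Function.update g i a)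
    rw [Finset.sum_insert hi, Function.update_self, ← add_assoc] at this
    refine le_trans (le_of_eq ?_) this
    congr 1
    refine Finset.sum_congr rfl fun j hj => ?_
    rw [Function.update_of_ne (ne_of_mem_of_not_mem hj hi)]

theorem youngConj_mono (A : ℝ → ℝ≥0∞) : Monotone (youngConj A) := fun _ _ hxy =>
  iSup₂_mono fun _ hτ =>
    tsub_le_tsub_right (ENNReal.ofReal_le_ofReal (mul_le_mul_of_nonneg_left hxy hτ)) _

/-- A weighted Young-type inequality passes to the conjugate function. -/
theorem sum_youngConj_le {A : ℝ → ℝ≥0∞} (hA0 : A 0 = 0) (w h : ℕ → ℝ) (hw : ∀ j, 0 ≤ w j)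
    (hh : ∀ j, 0 ≤ h j) (N : ℕ)
    (H : ∀ g : ℕ → ℝ, (∀ j, 0 ≤ g j) → (∀ j, A (g j) ≠ ⊤) →
      ∑ j ∈ Finset.range N, w j * (g j * h j) ≤
        1 + ∑ j ∈ Finset.range N, w j * (A (g j)).toReal) :
    ∑ j ∈ Finset.range N, ENNReal.ofReal (w j) * youngConj A (h j) ≤ 1 := by
  classical
  have : Nonempty {τ : ℝ // 0 ≤ τ} := ⟨⟨0, le_rfl⟩⟩
  have key := add_sum_iSup_le
    (fun (j : ℕ) (τ : {τ : ℝ // 0 ≤ τ}) =>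
      ENNReal.ofReal (w j) * (ENNReal.ofReal (τ * h j) - A τ)) (Finset.range N) 0 1 ?_
  · simpa only [youngConj, iSup_subtype', ENNReal.mul_iSup, zero_add] using key
  intro g
  set g' : ℕ → ℝ := fun j => if A (g j) ≤ ENNReal.ofReal (g j * h j) then (g j : ℝ) else 0 with hg'
  have hg0 : ∀ j, 0 ≤ g' j := fun j => by
    simp only [hg']; split_ifs; exacts [(g j).2, le_rfl]
  have hgA : ∀ j, A (g' j) ≠ ⊤ := fun j => by
    simp only [hg']; split_ifs with hj
    · exact ne_top_of_le_ne_top ENNReal.ofReal_ne_top hj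
    · simp [hA0]
  have hle : ∀ j, (A (g' j)).toReal ≤ g' j * h j := fun j => by
    simp only [hg']; split_ifs with hj
    · exact ENNReal.toReal_le_of_le_ofReal (mul_nonneg (g j).2 (hh j)) hj
    · simp [hA0]
  have hterm : ∀ j, ENNReal.ofReal (w j) * (ENNReal.ofReal (g j * h j) - A (g j)) ≤
      ENNReal.ofReal (w j * (g' j * h j) - w j * (A (g' j)).toReal) := fun j => by
    rw [← mul_sub, ENNReal.ofReal_mul (hw j)]
    by_cases hj : A (g j) ≤ ENNReal.ofReal (g j * h j)
    · have : g' j = g j := if_pos hj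
      rw [ENNReal.ofReal_sub _ ENNReal.toReal_nonneg, ENNReal.ofReal_toReal (hgA j), this]
    · rw [tsub_eq_zero_of_le (not_le.1 hj).le, mul_zero]
      exact zero_le
  rw [zero_add]
  calc _ ≤ ∑ j ∈ Finset.range N,
        ENNReal.ofReal (w j * (g' j * h j) - w j * (A (g' j)).toReal) :=
        Finset.sum_le_sum fun j _ => hterm j
    _ = ENNReal.ofReal (∑ j ∈ Finset.range N,
          (w j * (g' j * h j) - w j * (A (g' j)).toReal)) := by
        rw [ENNReal.ofReal_sum_of_nonneg]
        exact fun j _ => sub_nonneg.2 (mul_le_mul_of_nonneg_left (hle j) (hw j))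
    _ ≤ 1 := by
        rw [ENNReal.ofReal_le_one, Finset.sum_sub_distrib]
        linarith [H g' hg0 hgA]

theorem lintegral_Ioc_le_tsum {f : ℝ → ℝ≥0∞} (hf : Monotone f) {a β q : ℝ} (ha : 0 < a)
    (hβ0 : 0 < β) (hβ1 : β < 1) (hq : 0 ≤ q) :
    ∫⁻ τ in Set.Ioc 0 a, f τ * ENNReal.ofReal (τ ^ (-1 - q)) ≤
      ENNReal.ofReal (β ^ (-1 - q)) *
        ∑' j : ℕ, ENNReal.ofReal ((a * β ^ j) ^ (-q)) * f (a * β ^ j) := by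
  have hcov : Set.Ioc 0 a ⊆ ⋃ j : ℕ, Set.Ioc (a * β ^ (j + 1)) (a * β ^ j) := by
    intro τ hτ
    obtain ⟨j, hj1, hj2⟩ := exists_nat_pow_near_of_lt_one (div_pos hτ.1 ha)
      ((div_le_one ha).2 hτ.2) hβ0 hβ1
    rw [lt_div_iff₀' ha] at hj1
    rw [div_le_iff₀' ha] at hj2
    exact mem_iUnion.2 ⟨j, hj1, hj2⟩
  calc _ ≤ ∫⁻ τ in ⋃ j : ℕ, Set.Ioc (a * β ^ (j + 1)) (a * β ^ j),
        f τ * ENNReal.ofReal (τ ^ (-1 - q)) := lintegral_mono_set hcov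
    _ ≤ ∑' j : ℕ, ∫⁻ τ in Set.Ioc (a * β ^ (j + 1)) (a * β ^ j),
        f τ * ENNReal.ofReal (τ ^ (-1 - q)) := lintegral_iUnion_le _ _
    _ ≤ ∑' j : ℕ, ENNReal.ofReal (β ^ (-1 - q)) *
        (ENNReal.ofReal ((a * β ^ j) ^ (-q)) * f (a * β ^ j)) := by
        refine ENNReal.tsum_le_tsum fun j => ?_
        have hp : 0 < a * β ^ j := by positivity
        have hpe : a * β ^ (j + 1) = a * β ^ j * β := by ring
        rw [hpe]
        generalize a * β ^ j = p at hp
        calc _ ≤ ∫⁻ _ in Set.Ioc (p * β) p, f p * ENNReal.ofReal ((p * β) ^ (-1 - q)) := by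
              refine setLIntegral_mono' measurableSet_Ioc fun τ hτ => ?_
              refine mul_le_mul' (hf hτ.2) (ENNReal.ofReal_le_ofReal ?_)
              exact Real.rpow_le_rpow_of_nonpos (by positivity) hτ.1.le (by linarith)
          _ = f p * ENNReal.ofReal ((p * β) ^ (-1 - q)) * ENNReal.ofReal (p - p * β) := by
              rw [setLIntegral_const, Real.volume_Ioc]
          _ ≤ f p * ENNReal.ofReal ((p * β) ^ (-1 - q)) * ENNReal.ofReal p := by
              gcongr
              nlinarith
          _ = _ := by
              rw [mul_assoc, ← ENNReal.ofReal_mul (by positivity), mul_comm, ← mul_assoc,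
                ← ENNReal.ofReal_mul (by positivity)]
              congr 2
              rw [Real.mul_rpow hp.le hβ0.le, show -1 - q = -q - 1 by ring, Real.rpow_sub_one hp.ne']
              field_simp
    _ = _ := ENNReal.tsum_mul_left

theorem Fk_mono {n : ℕ} {s : ℝ} {k : ℕ} (hsk : s < (n : ℝ) + (k : ℝ) + 1) (A : ℝ → ℝ≥0∞)
    {x y : ℝ} (hx : 0 ≤ x) (hxy : x ≤ y) : Fk n s k A x ≤ Fk n s k A y := by
  refine mul_le_mul' (ENNReal.ofReal_le_ofReal (Real.rpow_le_rpow hx hxy ?_))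
    (lintegral_mono_set (Set.Ioc_subset_Ioc_right hxy))
  exact div_nonneg (Nat.cast_nonneg n) (by linarith)

theorem Fk_div_le {n : ℕ} {s : ℝ} {k : ℕ} (A : ℝ → ℝ≥0∞) (hsk : s < (n : ℝ) + (k : ℝ) + 1)
    (hks : (k : ℝ) + 1 < s) {x a : ℝ} (hx : 0 ≤ x) (ha : 1 ≤ a) :
    Fk n s k A (x / a) ≤ ENNReal.ofReal a⁻¹ * Fk n s k A x := by
  have hq : 1 ≤ (n : ℝ) / ((n : ℝ) - s + k + 1) := (one_le_div (by linarith)).2 (by linarith)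
  have ha0 : 0 < a := by linarith
  rw [Fk, Fk, ← mul_assoc, ← ENNReal.ofReal_mul (by positivity)]
  refine mul_le_mul' (ENNReal.ofReal_le_ofReal ?_)
    (lintegral_mono_set (Set.Ioc_subset_Ioc_right (div_le_self hx ha)))
  rw [div_eq_inv_mul, Real.mul_rpow (by positivity) hx]
  gcongr
  rw [← Real.rpow_one a⁻¹]
  conv_lhs => rw [Real.rpow_one]
  exact Real.rpow_le_rpow_of_exponent_ge (by positivity) (inv_le_one_of_one_le₀ ha) hq

theorem le_rcInv_or_eq_zero {F : ℝ → ℝ≥0∞} {x : ℝ} {v : ℝ≥0∞}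
    (hF : ∀ τ, 0 ≤ τ → τ ≤ x → F τ ≤ v) : x ≤ rcInv F v ∨ rcInv F v = 0 := by
  rcases Set.eq_empty_or_nonempty {τ : ℝ | 0 ≤ τ ∧ v < F τ} with h | h
  · right; rw [rcInv, h, Real.sInf_empty]
  · left
    refine le_csInf h fun τ hτ => ?_
    by_contra hlt
    exact absurd hτ.2 (not_lt.2 (hF τ hτ.1 (not_le.1 hlt).le))

/-- The dyadic inequality of `exists_dyadic_le` bounds `F_k`. -/
theorem Fk_le_of_dyadic {n : ℕ} (hn : 0 < n) {s : ℝ} {k : ℕ} (hsk : s < (n : ℝ) + (k : ℝ) + 1)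
    {A : ℝ → ℝ≥0∞} (hA0 : A 0 = 0) {R S : ℝ} (hR : 0 < R) (hS : 0 < S)
    (H : ∀ (N : ℕ) (g : ℕ → ℝ), (∀ j, 0 ≤ g j) → (∀ j, A (g j) ≠ ⊤) →
      ∑ j ∈ Finset.range N, g j * (2 ^ j * R) ^ (s - (k + 1)) ≤
        S * (1 + ∑ j ∈ Finset.range N, (2 ^ j * R) ^ n * (A (g j)).toReal)) :
    Fk n s k A (R ^ (s - (k + 1) - n) / S) ≤
      ENNReal.ofReal (((2 : ℝ) ^ (s - (k + 1) - n)) ^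
        (-1 - (n : ℝ) / ((n : ℝ) - s + (k : ℝ) + 1)) * R ^ (-(n : ℝ))) := by
  set q : ℝ := (n : ℝ) / ((n : ℝ) - s + (k : ℝ) + 1) with hq
  set γ : ℝ := s - (k + 1) - n with hγ
  have hd : 0 < (n : ℝ) - s + (k : ℝ) + 1 := by linarith
  have hn' : (0 : ℝ) < n := by exact_mod_cast hn
  have hq0 : 0 < q := div_pos hn' hd
  have hγq : γ * q = -n := by
    rw [hq, mul_div_assoc', div_eq_iff hd.ne']
    ring
  have hγ0 : γ < 0 := by linarith
  set β : ℝ := (2 : ℝ) ^ γ with hβ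
  have hβ0 : 0 < β := by positivity
  have hβ1 : β < 1 := Real.rpow_lt_one_of_one_lt_of_neg one_lt_two hγ0
  have hρ : ∀ j : ℕ, (0 : ℝ) < 2 ^ j * R := fun j => by positivity
  have hh : ∀ j : ℕ, R ^ γ / S * β ^ j = (2 ^ j * R) ^ γ / S := fun j => by
    rw [Real.mul_rpow (by positivity) hR.le, hβ, ← Real.rpow_natCast, ← Real.rpow_natCast,
      ← Real.rpow_mul zero_le_two, ← Real.rpow_mul zero_le_two, mul_comm γ]
    ring
  have hpow : ∀ x : ℝ, 0 < x → (x ^ γ / S) ^ (-q) = x ^ n * S ^ q := fun x hx => by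
    rw [Real.div_rpow (by positivity) hS.le, ← Real.rpow_mul hx.le, mul_neg, hγq, neg_neg,
      Real.rpow_natCast, Real.rpow_neg hS.le, div_inv_eq_mul]
  have hsum : ∀ N : ℕ, ∑ j ∈ Finset.range N, ENNReal.ofReal ((2 ^ j * R) ^ n) *
      youngConj A ((2 ^ j * R) ^ γ / S) ≤ 1 := fun N => by
    refine sum_youngConj_le hA0 _ _ (fun j => by positivity) (fun j => by positivity) N
      fun g hg hgA => ?_
    have h := H N g hg hgA
    rw [← div_le_iff₀' hS, Finset.sum_div] at h
    refine le_trans (le_of_eq (Finset.sum_congr rfl fun j _ => ?_)) h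
    rw [hγ, Real.rpow_sub (hρ j) _ (n : ℝ), Real.rpow_natCast]
    have := (pow_pos (hρ j) n).ne'
    field_simp
  have htsum : ∑' j : ℕ, ENNReal.ofReal ((R ^ γ / S * β ^ j) ^ (-q)) *
      youngConj A (R ^ γ / S * β ^ j) ≤ ENNReal.ofReal (S ^ q) := by
    have e : ∀ j : ℕ, ENNReal.ofReal ((R ^ γ / S * β ^ j) ^ (-q)) *
        youngConj A (R ^ γ / S * β ^ j) = ENNReal.ofReal (S ^ q) *
          (ENNReal.ofReal ((2 ^ j * R) ^ n) * youngConj A ((2 ^ j * R) ^ γ / S)) := fun j => by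
      rw [hh, hpow _ (hρ j), mul_comm _ (S ^ q), ENNReal.ofReal_mul (by positivity), mul_assoc]
    simp only [e, ENNReal.tsum_mul_left]
    exact mul_le_of_le_one_right' (ENNReal.tsum_le_of_sum_range_le hsum)
  have hx : 0 < R ^ γ / S := by positivity
  calc Fk n s k A (R ^ γ / S) ≤ ENNReal.ofReal ((R ^ γ / S) ^ q) *
        (ENNReal.ofReal (β ^ (-1 - q)) * ENNReal.ofReal (S ^ q)) := by
        refine mul_le_mul_right ?_ _
        refine (lintegral_Ioc_le_tsum (youngConj_mono A) hx hβ0 hβ1 hq0.le).trans ?_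
        exact mul_le_mul_right htsum _
    _ = _ := by
        rw [← ENNReal.ofReal_mul (by positivity), ← ENNReal.ofReal_mul (by positivity)]
        congr 1
        rw [Real.div_rpow (by positivity) hS.le, ← Real.rpow_mul hR.le, hγq]
        have := (Real.rpow_pos_of_pos hS q).ne'
        field_simp

/-- Optimality of `𝓛^{k,ψ^k_{s,A}}(ℝⁿ)` as a `k`-th order Campanato
target of `V^{s,A}_{d,k+1}(ℝⁿ)`: any admissible target `φ` satisfies `ψ^k_{s,A} ≲ φ`. -/
theorem stmt13 (n : ℕ) (hn : 0 < n) (s : ℝ) (hs1 : 1 < s) (hs2 : ∀ m : ℕ, s ≠ (m : ℝ))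
    (k : ℕ) (hk : k < ⌊s⌋₊) (hsk : s < (n : ℝ) + (k : ℝ) + 1)
    (A : ℝ → ℝ≥0∞) (hA : IsYoung A) (hint : IntCondK n s k A)
    (φ : ℝ → ℝ) (hφ : Admissible φ) (c : ℝ) (hc : 0 < c)
    (hemb : ∀ (u : Euc n → ℝ) (D : (h : ℕ) → Euc n → (Fin h → Fin n) → ℝ),
      HasWeakDerivs n ⌊s⌋₊ u D → DecayFrom n (k + 1) ⌊s⌋₊ D →
      fracSem n (s - (⌊s⌋₊ : ℝ)) A (D ⌊s⌋₊) < ⊤ →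
      campSemK n k φ u D ≤ ENNReal.ofReal c * fracSem n (s - (⌊s⌋₊ : ℝ)) A (D ⌊s⌋₊)) :
    ∃ c' : ℝ, 0 < c' ∧ ∀ r : ℝ, 0 < r → psiK n s k A r ≤ c' * φ r := by
  obtain ⟨M, hM, hdy⟩ := exists_dyadic_le hn hs1 hs2 k hA hφ hc hemb
  have hn' : (0 : ℝ) < n := by exact_mod_cast hn
  have hks : (k : ℝ) + 1 < s := by
    have h1 : ((k + 1 : ℕ) : ℝ) ≤ ⌊s⌋₊ := by exact_mod_cast hk
    have h2 := lt_of_le_of_ne (Nat.floor_le (by linarith)) (hs2 ⌊s⌋₊).symm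
    push_cast at h1
    linarith
  set V : ℝ := (volume (ball (0 : Euc n) 1)).toReal with hV
  have hVpos : 0 < V :=
    ENNReal.toReal_pos (measure_ball_pos _ _ one_pos).ne' measure_ball_lt_top.ne
  set κ : ℝ := V ^ ((n : ℝ)⁻¹) with hκ
  have hκ0 : 0 < κ := by positivity
  have hκn : κ ^ n = V := Real.rpow_inv_natCast_pow hVpos.le hn.ne'
  set b : ℝ := ((2 : ℝ) ^ (s - (k + 1) - n)) ^
    (-1 - (n : ℝ) / ((n : ℝ) - s + (k : ℝ) + 1)) * κ ^ (n : ℝ) with hb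
  set a : ℝ := max 1 b with ha
  have ha1 : 1 ≤ a := le_max_left _ _
  have ha0 : 0 < a := by linarith
  refine ⟨a * M * κ ^ (s - n), by positivity, fun r hr => ?_⟩
  have hφr := hφ.1 r hr
  set R : ℝ := r / κ with hR
  have hR0 : 0 < R := by positivity
  have hvol : (volume (ball (0 : Euc n) R)).toReal = r ^ n := by
    rw [Measure.addHaar_ball_of_pos _ _ hR0, ENNReal.toReal_mul,
      ENNReal.toReal_ofReal (by positivity), finrank_euclideanSpace, Fintype.card_fin, ← hV,
      ← hκn, hR, div_pow, div_mul_cancel₀ _ (by positivity)]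
  have hvol1 : (r ^ n) ^ ((n : ℝ)⁻¹) = r := Real.pow_rpow_inv_natCast hr.le hn.ne'
  have hvolk : (r ^ n) ^ ((k : ℝ) / (n : ℝ)) = r ^ k := by
    rw [← Real.rpow_natCast, ← Real.rpow_mul hr.le, mul_div_cancel₀ _ hn'.ne', Real.rpow_natCast]
  set S : ℝ := M * (φ r * r ^ k) / R ^ (k + 1) with hS
  have hS0 : 0 < S := by positivity
  set x : ℝ := R ^ (s - (k + 1) - n) / S with hx
  have hx0 : 0 < x := by positivity
  have hF : Fk n s k A x ≤ ENNReal.ofReal (b * r ^ (-(n : ℝ))) := by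
    refine (Fk_le_of_dyadic hn hsk hA.1 hR0 hS0 fun N g hg hgA => ?_).trans (le_of_eq ?_)
    · have h := hdy R hR0 N g hg hgA
      rw [hvol, hvol1, hvolk] at h
      rw [hS, div_mul_eq_mul_div, le_div_iff₀' (by positivity)]
      exact h
    · rw [hR, Real.div_rpow hr.le hκ0.le, Real.rpow_neg hκ0.le, div_inv_eq_mul, hb]
      congr 1
      ring
  have hFa : Fk n s k A (x / a) ≤ ENNReal.ofReal (r ^ (-(n : ℝ))) := by
    refine (Fk_div_le A hsk hks hx0.le ha1).trans ((mul_le_mul_right hF _).trans ?_)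
    rw [← ENNReal.ofReal_mul (by positivity)]
    refine ENNReal.ofReal_le_ofReal ?_
    rw [← mul_assoc]
    refine mul_le_of_le_one_left (by positivity) ?_
    rw [inv_mul_le_one₀ ha0]
    exact le_max_right _ _
  rcases le_rcInv_or_eq_zero fun τ h0 hτ => (Fk_mono hsk A h0 hτ).trans hFa with h | h
  · have hr' : 0 < r ^ ((n : ℝ) - s + (k : ℝ)) := by positivity
    calc psiK n s k A r ≤ (r ^ ((n : ℝ) - s + (k : ℝ)) * (x / a))⁻¹ := by
          rw [psiK]
          gcongr
      _ = a * M * κ ^ (s - n) * φ r := by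
          have e1 : R ^ (s - (k + 1) - n) * R ^ (k + 1) = r ^ (s - n) / κ ^ (s - n) := by
            rw [← Real.rpow_natCast R, ← Real.rpow_add hR0, hR, ← Real.div_rpow hr.le hκ0.le]
            congr 1
            push_cast
            ring
          have e2 : r ^ ((n : ℝ) - s + (k : ℝ)) * r ^ (s - n) = r ^ k := by
            rw [← Real.rpow_add hr, ← Real.rpow_natCast]
            congr 1
            ring
          have hk0 : 0 < κ ^ (s - n) := by positivity
          have hrk : 0 < r ^ k := by positivity
          have e3 : x / a = r ^ (s - n) / κ ^ (s - n) / (M * (φ r * r ^ k)) / a := by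
            rw [hx, hS, ← e1, div_div_eq_mul_div]
          rw [e3, show r ^ ((n : ℝ) - s + (k : ℝ)) *
            (r ^ (s - n) / κ ^ (s - n) / (M * (φ r * r ^ k)) / a) =
            (r ^ ((n : ℝ) - s + (k : ℝ)) * r ^ (s - n)) / κ ^ (s - n) / (M * (φ r * r ^ k)) / a
            by ring, e2]
          field_simp
  · rw [psiK, h, mul_zero, inv_zero]
    positivity
end

section
/- Let n ∈ ℕ, s ∈ (1,∞)\ℕ with s ∈ (1, n+[s]+1), and let A be a Young function. Then there exists a constant c = c(n,s) such that |u|_{𝓛^{[s],ψ^{[s]}_{s,A}}(ℝⁿ)} ≤ c |∇^{[s]}u|_{{s},A,ℝⁿ} for every u ∈ V^{s,A}(ℝⁿ), where ψ^{[s]}_{s,A}(r) = r^{{s}} A⁻¹(r^{−n}); in particular, V^{s,A}(ℝⁿ) is continuously embedded into the [s]-th order Campanato space 𝓛^{[s],ψ^{[s]}_{s,A}}(ℝⁿ). -/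
open MeasureTheory Metric Set Filter
open scoped ENNReal Topology

open scoped ContDiff

noncomputable section

/-- The partial derivative of `f` in the `j`-th coordinate direction. -/
def partialD {n : ℕ} (j : Fin n) (f : Euc n → ℝ) : Euc n → ℝ :=
  fun x => fderiv ℝ f x (EuclideanSpace.single j 1)

/-- The iterated partial derivative of `f` along a list of coordinate directions. -/
def listD {n : ℕ} (l : List (Fin n)) (f : Euc n → ℝ) : Euc n → ℝ :=
  l.foldr partialD f

/-- The restriction of a polynomial to Euclidean space. -/
def polyFun {n : ℕ} (P : MvPolynomial (Fin n) ℝ) : Euc n → ℝ :=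
  fun y => MvPolynomial.eval (fun i => y i) P

section PartialDerivatives

variable {n : ℕ} {f g : Euc n → ℝ}

@[simp]
theorem listD_nil (f : Euc n → ℝ) : listD [] f = f := rfl

@[simp]
theorem listD_cons (j : Fin n) (l : List (Fin n)) (f : Euc n → ℝ) :
    listD (j :: l) f = partialD j (listD l f) := rfl

theorem listD_append_singleton (l : List (Fin n)) (j : Fin n) (f : Euc n → ℝ) :
    listD (l ++ [j]) f = listD l (partialD j f) := by
  simp [listD]

theorem contDiff_partialD (hf : ContDiff ℝ ∞ f) (j : Fin n) : ContDiff ℝ ∞ (partialD j f) :=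
  (hf.fderiv_right (m := ∞) (by simp)).clm_apply contDiff_const

theorem contDiff_listD (hf : ContDiff ℝ ∞ f) (l : List (Fin n)) : ContDiff ℝ ∞ (listD l f) := by
  induction l with
  | nil => exact hf
  | cons j l ih => exact contDiff_partialD ih j

theorem partialD_comm (hf : ContDiff ℝ ∞ f) (i j : Fin n) :
    partialD i (partialD j f) = partialD j (partialD i f) := by
  have key : ∀ a b : Fin n, ∀ x, partialD a (partialD b f) x =
      fderiv ℝ (fderiv ℝ f) x (EuclideanSpace.single a 1) (EuclideanSpace.single b 1) := by
    intro a b x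
    have hd : DifferentiableAt ℝ (fderiv ℝ f) x :=
      ((hf.fderiv_right (m := ∞) (by simp)).differentiable (by simp)) x
    unfold partialD
    rw [fderiv_clm_apply hd (differentiableAt_const _)]
    simp
  funext x
  rw [key, key]
  have : IsSymmSndFDerivAt ℝ f x := hf.contDiffAt.isSymmSndFDerivAt
    (by rw [minSmoothness_of_isRCLikeNormedField]
        exact WithTop.coe_le_coe.2 (le_top (a := (2 : ℕ∞))))
  exact this _ _

theorem listD_perm (hf : ContDiff ℝ ∞ f) {l l' : List (Fin n)} (h : l.Perm l') :
    listD l f = listD l' f := by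
  induction h with
  | nil => rfl
  | cons a _ ih => simp [ih]
  | swap a b l => simpa using partialD_comm (contDiff_listD hf l) b a
  | trans _ _ h₁ h₂ => exact h₁.trans h₂

theorem iteratedFDeriv_single_eq_listD (hf : ContDiff ℝ ∞ f) (h : ℕ) (d : Fin h → Fin n)
    (x : Euc n) :
    iteratedFDeriv ℝ h f x (fun i => EuclideanSpace.single (d i) (1 : ℝ)) =
      listD (List.ofFn d) f x := by
  induction h generalizing x with
  | zero => simp
  | succ h ih =>
    rw [DifferentiableAt.iteratedFDeriv_succ_apply_left'
      ((hf.differentiable_iteratedFDeriv (m := h) (by exact_mod_cast WithTop.coe_lt_top _)) x)]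
    simp only [List.ofFn_succ, listD_cons, partialD]
    congr 2
    funext y
    exact ih (fun i => d i.succ) y

theorem partialD_sub (hf : ContDiff ℝ ∞ f) (hg : ContDiff ℝ ∞ g) (j : Fin n) :
    partialD j (fun x => f x - g x) = fun x => partialD j f x - partialD j g x := by
  funext x
  have h1 := (hf.differentiable (by simp)) x
  have h2 := (hg.differentiable (by simp)) x
  simp [partialD, fderiv_fun_sub h1 h2]

theorem listD_sub (hf : ContDiff ℝ ∞ f) (hg : ContDiff ℝ ∞ g) (l : List (Fin n)) :
    listD l (fun x => f x - g x) = fun x => listD l f x - listD l g x := by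
  induction l with
  | nil => rfl
  | cons j l ih =>
    rw [listD_cons, ih, partialD_sub (contDiff_listD hf l) (contDiff_listD hg l)]
    rfl

theorem hasCompactSupport_partialD (hf : HasCompactSupport f) (j : Fin n) :
    HasCompactSupport (partialD j f) :=
  hf.fderiv_apply ℝ _

theorem hasCompactSupport_listD (hf : HasCompactSupport f) (l : List (Fin n)) :
    HasCompactSupport (listD l f) := by
  induction l with
  | nil => exact hf
  | cons j l ih => exact hasCompactSupport_partialD ih j

theorem partialD_comp_sub_left (hf : ContDiff ℝ ∞ f) (j : Fin n) (x : Euc n) (c : ℝ) :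
    partialD j (fun y => c * f (x - y)) = fun y => -(c * partialD j f (x - y)) := by
  funext y
  have h1 : HasFDerivAt f (fderiv ℝ f (x - y)) (x - y) :=
    ((hf.differentiable (by simp)) (x - y)).hasFDerivAt
  have h2 : HasFDerivAt (fun y : Euc n => x - y) (-ContinuousLinearMap.id ℝ (Euc n)) y :=
    (hasFDerivAt_id y).const_sub x
  have h3 := (h1.comp y h2).const_mul c
  simp only [partialD]
  have h4 : (fun y => c * f (x - y)) = fun y => c * (f ∘ fun y => x - y) y := rfl
  rw [h4, h3.fderiv]
  simp

theorem listD_comp_sub_left (hf : ContDiff ℝ ∞ f) (l : List (Fin n)) (x : Euc n) :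
    listD l (fun y => f (x - y)) = fun y => (-1) ^ l.length * listD l f (x - y) := by
  induction l with
  | nil => simp
  | cons j l ih =>
    rw [listD_cons, ih, partialD_comp_sub_left (contDiff_listD hf l)]
    funext y
    simp [pow_succ]

end PartialDerivatives

section Polynomials

variable {n : ℕ}

theorem hasFDerivAt_polyFun (P : MvPolynomial (Fin n) ℝ) (x : Euc n) :
    HasFDerivAt (polyFun P)
      (∑ i, polyFun (MvPolynomial.pderiv i P) x • EuclideanSpace.proj (𝕜 := ℝ) i) x := by
  induction P using MvPolynomial.induction_on with
  | C a =>
    have : polyFun (MvPolynomial.C a : MvPolynomial (Fin n) ℝ) = fun _ => a := by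
      funext y; simp [polyFun]
    rw [this]
    simpa [polyFun] using hasFDerivAt_const a x
  | add p q hp hq =>
    have : polyFun (p + q) = fun y => polyFun p y + polyFun q y := by
      funext y; simp [polyFun]
    rw [this]
    convert! hp.add hq using 1
    simp [polyFun, add_smul, Finset.sum_add_distrib]
  | mul_X p j hp =>
    have : polyFun (p * MvPolynomial.X j) = fun y => polyFun p y * y j := by
      funext y; simp [polyFun]
    rw [this]
    have hj : HasFDerivAt (fun y : Euc n => y j) (EuclideanSpace.proj (𝕜 := ℝ) j) x :=
      (EuclideanSpace.proj (𝕜 := ℝ) j).hasFDerivAt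
    convert! hp.mul hj using 1
    ext v
    simp [polyFun, MvPolynomial.pderiv_X, add_smul,
      Finset.sum_add_distrib, Pi.single_apply, Finset.mul_sum]
    congr 1
    · rw [Finset.sum_eq_single j] <;> simp +contextual [eq_comm]
    · refine Finset.sum_congr rfl fun i _ => by ring

theorem contDiff_polyFun (P : MvPolynomial (Fin n) ℝ) : ContDiff ℝ ∞ (polyFun P) := by
  have h := (AnalyticOnNhd.eval_mvPolynomial (𝕜 := ℝ) P).contDiff (n := ∞)
  exact h.comp (contDiff_pi.2 fun i => (EuclideanSpace.proj (𝕜 := ℝ) i).contDiff)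

theorem partialD_polyFun (P : MvPolynomial (Fin n) ℝ) (j : Fin n) :
    partialD j (polyFun P) = polyFun (MvPolynomial.pderiv j P) := by
  funext x
  simp only [partialD, (hasFDerivAt_polyFun P x).fderiv]
  simp

theorem coeff_eq_zero_of_totalDegree_le {P : MvPolynomial (Fin n) ℝ} {k : ℕ}
    (hP : P.totalDegree ≤ k) {m : Fin n →₀ ℕ} (hm : k < m.degree) : P.coeff m = 0 := by
  by_contra h
  have := MvPolynomial.le_totalDegree (MvPolynomial.mem_support_iff.2 h)
  have h2 : (m.sum fun _ e => e) = m.degree := rfl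
  omega

theorem totalDegree_le_of_coeff {P : MvPolynomial (Fin n) ℝ} {k : ℕ}
    (h : ∀ m : Fin n →₀ ℕ, k < m.degree → P.coeff m = 0) : P.totalDegree ≤ k := by
  refine Finset.sup_le fun m hm => ?_
  by_contra hlt
  exact (MvPolynomial.mem_support_iff.1 hm) (h m (not_le.1 hlt))

theorem totalDegree_pderiv_le {P : MvPolynomial (Fin n) ℝ} {k : ℕ}
    (hP : P.totalDegree ≤ k + 1) (j : Fin n) : (MvPolynomial.pderiv j P).totalDegree ≤ k := by
  refine totalDegree_le_of_coeff fun m hm => ?_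
  rw [MvPolynomial.coeff_pderiv, coeff_eq_zero_of_totalDegree_le hP, zero_mul]
  simp
  omega

theorem eq_C_of_pderiv_eq_zero {P : MvPolynomial (Fin n) ℝ}
    (h : ∀ j, MvPolynomial.pderiv j P = 0) : P = MvPolynomial.C (P.coeff 0) := by
  ext m
  rw [MvPolynomial.coeff_C]
  split_ifs with h0
  · rw [h0]
  · obtain ⟨j, hj⟩ : ∃ j, m j ≠ 0 := by
      by_contra hcon
      push Not at hcon
      exact h0 (Finsupp.ext hcon).symm
    have := MvPolynomial.coeff_pderiv (i := j) P (m - Finsupp.single j 1)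
    rw [h j, MvPolynomial.coeff_zero] at this
    have hm : m - Finsupp.single j 1 + Finsupp.single j 1 = m := by
      refine tsub_add_cancel_of_le ?_
      rw [Finsupp.single_le_iff]
      omega
    rw [hm] at this
    rcases mul_eq_zero.1 this.symm with h | h
    · exact h
    · exact absurd h (by positivity)

theorem listD_polyFun_eq_const {P : MvPolynomial (Fin n) ℝ} (l : List (Fin n))
    (hP : P.totalDegree ≤ l.length) (x y : Euc n) :
    listD l (polyFun P) x = listD l (polyFun P) y := by
  induction l using List.reverseRecOn generalizing P with
  | nil =>
    have : P = MvPolynomial.C (P.coeff 0) := by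
      refine MvPolynomial.totalDegree_eq_zero_iff_eq_C.1 (by simpa using hP)
    rw [this]; simp [polyFun]
  | append_singleton l j ih =>
    rw [listD_append_singleton, partialD_polyFun]
    exact ih (totalDegree_pderiv_le (by simpa using hP) j)

theorem polynomial_eq_zero_of_setIntegral_eq_zero {B : Set (Euc n)} (hB0 : volume B ≠ 0)
    (hB : volume B ≠ ⊤) (k : ℕ) {P : MvPolynomial (Fin n) ℝ} (hP : P.totalDegree ≤ k)
    (h : ∀ l : List (Fin n), l.length ≤ k → ∫ x in B, listD l (polyFun P) x = 0) : P = 0 := by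
  have const : ∀ Q : MvPolynomial (Fin n) ℝ, Q = MvPolynomial.C (Q.coeff 0) →
      ∫ x in B, polyFun Q x = 0 → Q = 0 := by
    intro Q hQ h_int
    rw [hQ] at h_int ⊢
    have : (volume.real B) ≠ 0 := (ENNReal.toReal_pos hB0 hB).ne'
    simp only [polyFun, MvPolynomial.eval_C, setIntegral_const, smul_eq_mul] at h_int
    rcases mul_eq_zero.1 h_int with h | h
    · exact absurd h this
    · rw [h, map_zero]
  induction k generalizing P with
  | zero =>
    exact const P (MvPolynomial.totalDegree_eq_zero_iff_eq_C.1 (by simpa using hP))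
      (by simpa using h [] (by simp))
  | succ k ih =>
    refine const P (eq_C_of_pderiv_eq_zero fun j => ih (totalDegree_pderiv_le hP j) ?_)
      (by simpa using h [] (by simp))
    intro l hl
    rw [← partialD_polyFun, ← listD_append_singleton]
    exact h _ (by simpa using hl)

end Polynomials

section Projection

variable {n : ℕ}

theorem integrableOn_polyFun {B : Set (Euc n)} (hB : Bornology.IsBounded B)
    (P : MvPolynomial (Fin n) ℝ) : IntegrableOn (polyFun P) B := by
  refine IntegrableOn.mono_set ?_ subset_closure
  exact (contDiff_polyFun P).continuous.continuousOn.integrableOn_compact hB.isCompact_closure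

theorem listD_polyFun (l : List (Fin n)) (P : MvPolynomial (Fin n) ℝ) :
    listD l (polyFun P) = polyFun (l.foldr (fun j Q => MvPolynomial.pderiv j Q) P) := by
  induction l with
  | nil => rfl
  | cons j l ih => rw [listD_cons, ih, partialD_polyFun]; rfl

theorem foldr_pderiv_add (l : List (Fin n)) (P Q : MvPolynomial (Fin n) ℝ) :
    l.foldr (fun j Q => MvPolynomial.pderiv j Q) (P + Q) =
      l.foldr (fun j Q => MvPolynomial.pderiv j Q) P +
        l.foldr (fun j Q => MvPolynomial.pderiv j Q) Q := by
  induction l with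
  | nil => rfl
  | cons j l ih => simp [ih]

theorem foldr_pderiv_smul (l : List (Fin n)) (a : ℝ) (P : MvPolynomial (Fin n) ℝ) :
    l.foldr (fun j Q => MvPolynomial.pderiv j Q) (a • P) =
      a • l.foldr (fun j Q => MvPolynomial.pderiv j Q) P := by
  induction l with
  | nil => rfl
  | cons j l ih => simp [ih]

/-- The integral over `B` of an iterated partial derivative, as a functional on polynomials. -/
def derivIntegral {B : Set (Euc n)} (hB : Bornology.IsBounded B) (l : List (Fin n)) :
    MvPolynomial (Fin n) ℝ →ₗ[ℝ] ℝ where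
  toFun P := ∫ x in B, listD l (polyFun P) x
  map_add' P Q := by
    simp only [listD_polyFun, foldr_pderiv_add]
    rw [← integral_add (integrableOn_polyFun hB _) (integrableOn_polyFun hB _)]
    simp [polyFun]
  map_smul' a P := by
    simp only [listD_polyFun, foldr_pderiv_smul]
    simp [polyFun, integral_const_mul]

theorem exists_polynomial_setIntegral_eq {B : Set (Euc n)} (hB0 : volume B ≠ 0)
    (hB : Bornology.IsBounded B) (k : ℕ) (I : List (Fin n) → ℝ)
    (hI : ∀ l l' : List (Fin n), l.Perm l' → l.length ≤ k → I l = I l') :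
    ∃ P : MvPolynomial (Fin n) ℝ, P.totalDegree ≤ k ∧
      ∀ l : List (Fin n), l.length ≤ k → ∫ x in B, listD l (polyFun P) x = I l := by
  classical
  let S := {α : Fin n →₀ ℕ // α.degree ≤ k}
  have : Finite S := Finsupp.finite_of_degree_le k
  have : Fintype S := Fintype.ofFinite S
  let L : (Fin n →₀ ℕ) → List (Fin n) := fun α => (Finsupp.toMultiset α).toList
  have hL : ∀ l : List (Fin n), (L (Multiset.toFinsupp (l : Multiset (Fin n)))).Perm l := by
    intro l
    rw [← Multiset.coe_eq_coe]
    simp [L]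
  have hdeg : ∀ l : List (Fin n),
      (Multiset.toFinsupp (l : Multiset (Fin n))).degree = l.length := by
    intro l
    have := Finsupp.card_toMultiset (Multiset.toFinsupp (l : Multiset (Fin n)))
    rw [Multiset.toFinsupp_toMultiset] at this
    exact this.symm
  let E : (S → ℝ) →ₗ[ℝ] MvPolynomial (Fin n) ℝ :=
    ∑ α : S, (LinearMap.proj (R := ℝ) (φ := fun _ : S => ℝ) α).smulRight
      (MvPolynomial.monomial α.1 (1 : ℝ))
  have hE : ∀ c, E c = ∑ α : S, c α • MvPolynomial.monomial α.1 (1 : ℝ) := by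
    intro c; simp [E]
  have hEcoeff : ∀ c (α : S), (E c).coeff α.1 = c α := by
    intro c α
    rw [hE, MvPolynomial.coeff_sum, Finset.sum_eq_single α]
    · simp
    · intro β _ hβ
      have : β.1 ≠ α.1 := fun h => hβ (Subtype.ext h)
      simp [MvPolynomial.coeff_monomial, this]
    · simp
  have hEdeg : ∀ c, (E c).totalDegree ≤ k := by
    intro c
    refine totalDegree_le_of_coeff fun m hm => ?_
    rw [hE, MvPolynomial.coeff_sum]
    refine Finset.sum_eq_zero fun α _ => ?_
    have : α.1 ≠ m := by
      rintro rfl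
      exact absurd α.2 (not_le.2 hm)
    simp [MvPolynomial.coeff_monomial, this]
  let T : (S → ℝ) →ₗ[ℝ] (S → ℝ) := LinearMap.pi fun α => derivIntegral hB (L α.1) ∘ₗ E
  have hTall : ∀ c (l : List (Fin n)) (hl : l.length ≤ k),
      ∫ x in B, listD l (polyFun (E c)) x =
        T c ⟨Multiset.toFinsupp (l : Multiset (Fin n)), (hdeg l).le.trans hl⟩ := by
    intro c l hl
    change _ = ∫ x in B, listD (L (Multiset.toFinsupp (l : Multiset (Fin n)))) (polyFun (E c)) x
    rw [listD_perm (contDiff_polyFun _) (hL l)]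
  have hinj : Function.Injective T := by
    rw [← LinearMap.ker_eq_bot, LinearMap.ker_eq_bot']
    intro c hc
    have h0 : E c = 0 := by
      refine polynomial_eq_zero_of_setIntegral_eq_zero hB0 hB.measure_lt_top.ne k (hEdeg c) ?_
      intro l hl
      rw [hTall c l hl, hc]
      rfl
    funext α
    rw [← hEcoeff c α, h0]
    simp
  obtain ⟨c, hc⟩ := (LinearMap.injective_iff_surjective.1 hinj) fun α => I (L α.1)
  refine ⟨E c, hEdeg c, fun l hl => ?_⟩
  rw [hTall c l hl, hc]
  exact hI _ _ (hL l) (by rw [(hL l).length_eq]; exact hl)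

end Projection

section Poincare

variable {n : ℕ}

theorem lintegral_enorm_le_mean_add {B : Set (Euc n)} {f : Euc n → ℝ} (hB0 : volume B ≠ 0)
    (hB : volume B ≠ ⊤) (hf : IntegrableOn f B) :
    ∫⁻ x in B, ‖f x‖ₑ ≤ ‖∫ x in B, f x‖ₑ +
      (volume B)⁻¹ * ∫⁻ x in B, ∫⁻ y in B, ‖f x - f y‖ₑ := by
  have hpt : ∀ x, ‖f x‖ₑ ≤ (volume B)⁻¹ * ‖∫ y in B, f y‖ₑ +
      (volume B)⁻¹ * ∫⁻ y in B, ‖f x - f y‖ₑ := by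
    intro x
    rw [← mul_add, mul_comm (volume B)⁻¹, ← div_eq_mul_inv,
      ENNReal.le_div_iff_mul_le (Or.inl hB0) (Or.inl hB)]
    have hc : IntegrableOn (fun _ : Euc n => f x) B := integrableOn_const hB
    have h1 : ‖∫ _ in B, f x‖ₑ = ‖f x‖ₑ * volume B := by
      rw [setIntegral_const, smul_eq_mul, enorm_mul, mul_comm]
      congr 1
      rw [Measure.real, Real.enorm_eq_ofReal ENNReal.toReal_nonneg, ENNReal.ofReal_toReal hB]
    have h2 : ∫ _ in B, f x = (∫ y in B, f y) + ∫ y in B, (f x - f y) := by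
      rw [integral_sub hc hf]; ring
    rw [← h1, h2]
    exact (enorm_add_le _ _).trans (add_le_add le_rfl (enorm_integral_le_lintegral_enorm _))
  calc ∫⁻ x in B, ‖f x‖ₑ ≤ ∫⁻ x in B, ((volume B)⁻¹ * ‖∫ y in B, f y‖ₑ +
      (volume B)⁻¹ * ∫⁻ y in B, ‖f x - f y‖ₑ) := lintegral_mono hpt
    _ = _ := by
      rw [lintegral_add_left measurable_const, setLIntegral_const,
        lintegral_const_mul' _ _ (ENNReal.inv_ne_top.2 hB0), mul_right_comm,
        ENNReal.inv_mul_cancel hB0 hB, one_mul]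

theorem lintegral_comp_segment_le {G : Euc n → ℝ≥0∞} (hG : Measurable G) {t : ℝ}
    (ht : t ≤ 1 / 2) (y : Euc n) :
    ∫⁻ x, G (x + t • (y - x)) ≤ 2 ^ n * ∫⁻ x, G x := by
  have h1 : ∀ x : Euc n, x + t • (y - x) = (1 - t) • x + t • y := by
    intro x; module
  have hpos : (0 : ℝ) < 1 - t := by linarith
  have h2 : ∫⁻ x, G ((1 - t) • x + t • y) =
      ∫⁻ z, G (z + t • y) ∂(Measure.map (fun x : Euc n => (1 - t) • x) volume) := by
    rw [lintegral_map (by fun_prop) (by fun_prop)]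
  simp_rw [h1]
  rw [h2, Measure.map_addHaar_smul _ hpos.ne', lintegral_smul_measure,
    lintegral_add_right_eq_self, smul_eq_mul]
  gcongr
  rw [finrank_euclideanSpace_fin, abs_of_pos (by positivity), ← inv_pow,
    ENNReal.ofReal_pow (by positivity)]
  gcongr
  rw [← ENNReal.ofReal_ofNat]
  refine ENNReal.ofReal_le_ofReal ?_
  rw [inv_le_comm₀ hpos (by norm_num)]
  linarith

theorem enorm_sub_midpoint_le {f : Euc n → ℝ} (hf : ContDiff ℝ ∞ f) (x y : Euc n) :
    ‖f x - f (x + (1 / 2 : ℝ) • (y - x))‖ₑ ≤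
      (∫⁻ t in Ioc (0 : ℝ) (1 / 2), ‖fderiv ℝ f (x + t • (y - x))‖ₑ) * ‖y - x‖ₑ := by
  have hcont : Continuous fun t : ℝ => fderiv ℝ f (x + t • (y - x)) (y - x) := by
    have := (hf.continuous_fderiv (by simp))
    exact (this.comp (by fun_prop)).clm_apply continuous_const
  have hderiv : ∀ t : ℝ, HasDerivAt (fun t : ℝ => f (x + t • (y - x)))
      (fderiv ℝ f (x + t • (y - x)) (y - x)) t := by
    intro t
    have h1 : HasFDerivAt f _ (x + t • (y - x)) :=
      ((hf.differentiable (by simp)) (x + t • (y - x))).hasFDerivAt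
    have h2 : HasDerivAt (fun t : ℝ => x + t • (y - x)) (y - x) t := by
      simpa using ((hasDerivAt_id t).smul_const (y - x)).const_add x
    exact h1.comp_hasDerivAt t h2
  have hftc := intervalIntegral.integral_eq_sub_of_hasDerivAt (a := 0) (b := 1 / 2)
    (fun t _ => hderiv t) (hcont.intervalIntegrable _ _)
  simp only [zero_smul, add_zero] at hftc
  rw [enorm_sub_rev, ← hftc, intervalIntegral.integral_of_le (by norm_num),
    ← lintegral_mul_const' _ _ enorm_ne_top]
  refine (enorm_integral_le_lintegral_enorm _).trans (lintegral_mono fun t => ?_)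
  exact ContinuousLinearMap.le_opENorm _ _

theorem enorm_fderiv_le_sum (f : Euc n → ℝ) (x : Euc n) :
    ‖fderiv ℝ f x‖ₑ ≤ ∑ j, ‖partialD j f x‖ₑ := by
  have hreal : ‖fderiv ℝ f x‖ ≤ ∑ j, ‖partialD j f x‖ := by
    refine ContinuousLinearMap.opNorm_le_bound _ (by positivity) fun v => ?_
    have hv : v = ∑ j, v j • EuclideanSpace.single j (1 : ℝ) := by
      ext i; simp [Pi.single_apply]
    conv_lhs => rw [hv]
    rw [map_sum, Finset.sum_mul]
    refine (norm_sum_le _ _).trans (Finset.sum_le_sum fun j _ => ?_)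
    rw [map_smul, norm_smul, mul_comm]
    exact mul_le_mul_of_nonneg_left (PiLp.norm_apply_le v j) (norm_nonneg _)
  simp only [← ofReal_norm]
  rw [← ENNReal.ofReal_sum_of_nonneg fun _ _ => norm_nonneg _]
  exact ENNReal.ofReal_le_ofReal hreal

theorem lintegral_midpoint_le {f : Euc n → ℝ} (hf : ContDiff ℝ ∞ f) (x₀ : Euc n) {R : ℝ} :
    ∫⁻ x in ball x₀ R, ∫⁻ y in ball x₀ R, ‖f x - f (x + (1 / 2 : ℝ) • (y - x))‖ₑ ≤
      volume (ball x₀ R) * (ENNReal.ofReal (2 * R) * 2 ^ n) *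
        ∫⁻ x in ball x₀ R, ‖fderiv ℝ f x‖ₑ := by
  set B := ball x₀ R with hBdef
  set G : Euc n → ℝ≥0∞ := B.indicator fun z => ‖fderiv ℝ f z‖ₑ with hGdef
  have hG : Measurable G := by
    refine Measurable.indicator ?_ measurableSet_ball
    exact (hf.continuous_fderiv (by simp)).enorm.measurable
  have hpt : ∀ x ∈ B, ∀ y ∈ B, ‖f x - f (x + (1 / 2 : ℝ) • (y - x))‖ₑ ≤
      (∫⁻ t in Ioc (0 : ℝ) (1 / 2), G (x + t • (y - x))) * ENNReal.ofReal (2 * R) := by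
    intro x hx y hy
    refine (enorm_sub_midpoint_le hf x y).trans (mul_le_mul' ?_ ?_)
    · refine setLIntegral_mono' measurableSet_Ioc fun t ht => ?_
      have hmem : x + t • (y - x) ∈ B :=
        (convex_ball x₀ R).add_smul_sub_mem hx hy ⟨ht.1.le, by linarith [ht.2]⟩
      simp [hGdef, hmem]
    · rw [← ofReal_norm]
      refine ENNReal.ofReal_le_ofReal ?_
      rw [← dist_eq_norm]
      have := dist_triangle_right y x x₀
      rw [hBdef, mem_ball] at hx hy
      linarith
  have hmeas : Measurable fun p : Euc n × Euc n × ℝ => G (p.1 + p.2.2 • (p.2.1 - p.1)) :=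
    hG.comp (by fun_prop)
  calc ∫⁻ x in B, ∫⁻ y in B, ‖f x - f (x + (1 / 2 : ℝ) • (y - x))‖ₑ
      ≤ ∫⁻ x in B, ∫⁻ y in B, (∫⁻ t in Ioc (0 : ℝ) (1 / 2), G (x + t • (y - x))) *
          ENNReal.ofReal (2 * R) :=
        setLIntegral_mono' measurableSet_ball fun x hx =>
          setLIntegral_mono' measurableSet_ball fun y hy => hpt x hx y hy
    _ = (∫⁻ y in B, ∫⁻ t in Ioc (0 : ℝ) (1 / 2), ∫⁻ x in B, G (x + t • (y - x))) *
          ENNReal.ofReal (2 * R) := by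
        simp_rw [lintegral_mul_const' _ _ ENNReal.ofReal_ne_top]
        congr 1
        rw [lintegral_lintegral_swap]
        · refine lintegral_congr fun y => ?_
          rw [lintegral_lintegral_swap]
          exact (hmeas.comp (f := fun q : Euc n × ℝ => (q.1, y, q.2)) (by fun_prop)).aemeasurable
        · refine Measurable.aemeasurable ?_
          exact Measurable.lintegral_prod_right'
            (f := fun q : (Euc n × Euc n) × ℝ => G (q.1.1 + q.2 • (q.1.2 - q.1.1)))
            (hG.comp (by fun_prop))
    _ ≤ (∫⁻ _ in B, ∫⁻ _ in Ioc (0 : ℝ) (1 / 2), 2 ^ n * ∫⁻ x, G x) *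
          ENNReal.ofReal (2 * R) := by
        gcongr ?_ * _
        refine lintegral_mono fun y => setLIntegral_mono' measurableSet_Ioc fun t ht => ?_
        exact (setLIntegral_le_lintegral _ _).trans (lintegral_comp_segment_le hG ht.2 y)
    _ ≤ ((2 ^ n * ∫⁻ x, G x) * 1 * volume B) * ENNReal.ofReal (2 * R) := by
        rw [setLIntegral_const, setLIntegral_const]
        gcongr
        rw [Real.volume_Ioc]
        exact ENNReal.ofReal_le_one.2 (by norm_num)
    _ = _ := by
        rw [hGdef, lintegral_indicator measurableSet_ball]
        ring

/-- The `L¹` Poincaré inequality on balls, in terms of differences. -/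
theorem lintegral_lintegral_enorm_sub_le {f : Euc n → ℝ} (hf : ContDiff ℝ ∞ f) (x₀ : Euc n)
    {R : ℝ} :
    ∫⁻ x in ball x₀ R, ∫⁻ y in ball x₀ R, ‖f x - f y‖ₑ ≤
      volume (ball x₀ R) * (2 * (ENNReal.ofReal (2 * R) * 2 ^ n)) *
        ∑ j, ∫⁻ x in ball x₀ R, ‖partialD j f x‖ₑ := by
  have hcf := hf.continuous
  have hsplit : ∀ x y : Euc n, ‖f x - f y‖ₑ ≤ ‖f x - f (x + (1 / 2 : ℝ) • (y - x))‖ₑ +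
      ‖f y - f (y + (1 / 2 : ℝ) • (x - y))‖ₑ := by
    intro x y
    have hmid : y + (1 / 2 : ℝ) • (x - y) = x + (1 / 2 : ℝ) • (y - x) := by module
    rw [hmid]
    have : f x - f y = (f x - f (x + (1 / 2 : ℝ) • (y - x))) -
      (f y - f (x + (1 / 2 : ℝ) • (y - x))) := by ring
    rw [this]
    exact enorm_sub_le
  have hswap : ∫⁻ x in ball x₀ R, ∫⁻ y in ball x₀ R, ‖f y - f (y + (1 / 2 : ℝ) • (x - y))‖ₑ =
      ∫⁻ x in ball x₀ R, ∫⁻ y in ball x₀ R, ‖f x - f (x + (1 / 2 : ℝ) • (y - x))‖ₑ := by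
    rw [lintegral_lintegral_swap]
    refine Continuous.aemeasurable ?_
    unfold Function.uncurry
    fun_prop
  calc ∫⁻ x in ball x₀ R, ∫⁻ y in ball x₀ R, ‖f x - f y‖ₑ
      ≤ ∫⁻ x in ball x₀ R, ∫⁻ y in ball x₀ R, (‖f x - f (x + (1 / 2 : ℝ) • (y - x))‖ₑ +
        ‖f y - f (y + (1 / 2 : ℝ) • (x - y))‖ₑ) :=
        lintegral_mono fun x => lintegral_mono fun y => hsplit x y
    _ = 2 * ∫⁻ x in ball x₀ R, ∫⁻ y in ball x₀ R,
          ‖f x - f (x + (1 / 2 : ℝ) • (y - x))‖ₑ := by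
        rw [two_mul]
        conv_rhs => arg 2; rw [← hswap]
        rw [← lintegral_add_left]
        · refine lintegral_congr fun x => ?_
          rw [lintegral_add_left]
          exact Continuous.measurable (by fun_prop)
        · refine Measurable.lintegral_prod_right'
            (f := fun p : Euc n × Euc n => ‖f p.1 - f (p.1 + (1 / 2 : ℝ) • (p.2 - p.1))‖ₑ) ?_
          exact Continuous.measurable (by fun_prop)
    _ ≤ 2 * (volume (ball x₀ R) * (ENNReal.ofReal (2 * R) * 2 ^ n) *
        ∫⁻ x in ball x₀ R, ∑ j, ‖partialD j f x‖ₑ) := by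
        gcongr 2 * ?_
        refine (lintegral_midpoint_le hf x₀).trans ?_
        gcongr
        exact enorm_fderiv_le_sum f _
    _ = _ := by
        rw [lintegral_finsetSum]
        · ring
        · intro j _
          exact (contDiff_partialD hf j).continuous.enorm.measurable

/-- The integral of `|f|` over a ball is controlled by its mean and its gradient. -/
theorem lintegral_enorm_le_partialD {f : Euc n → ℝ} (hf : ContDiff ℝ ∞ f) (x₀ : Euc n)
    {R : ℝ} (hR : 0 < R) :
    ∫⁻ x in ball x₀ R, ‖f x‖ₑ ≤ ‖∫ x in ball x₀ R, f x‖ₑ +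
      2 * (ENNReal.ofReal (2 * R) * 2 ^ n) * ∑ j, ∫⁻ x in ball x₀ R, ‖partialD j f x‖ₑ := by
  have hB0 : volume (ball x₀ R) ≠ 0 := (measure_ball_pos _ _ hR).ne'
  have hB : volume (ball x₀ R) ≠ ⊤ := measure_ball_lt_top.ne
  have h_int : IntegrableOn f (ball x₀ R) :=
    (hf.continuous.continuousOn.integrableOn_compact
      (isCompact_closedBall x₀ R)).mono_set ball_subset_closedBall
  refine (lintegral_enorm_le_mean_add hB0 hB h_int).trans ?_
  refine add_le_add le_rfl ?_
  refine (mul_le_mul' le_rfl (lintegral_lintegral_enorm_sub_le hf x₀)).trans_eq ?_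
  rw [← mul_assoc, ← mul_assoc, ENNReal.inv_mul_cancel hB0 hB, one_mul]

theorem sum_listD_ofFn_succ {M : Type*} [AddCommMonoid M] (F : List (Fin n) → M) (h : ℕ) :
    ∑ d : Fin (h + 1) → Fin n, F (List.ofFn d) =
      ∑ d : Fin h → Fin n, ∑ j, F (j :: List.ofFn d) := by
  rw [← (Fin.consEquiv fun _ : Fin (h + 1) => Fin n).sum_comp, Fintype.sum_prod_type,
    Finset.sum_comm]
  refine Finset.sum_congr rfl fun d _ => Finset.sum_congr rfl fun j _ => ?_
  simp [Fin.consEquiv, List.ofFn_succ]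

/-- The iterated Poincaré inequality on balls. -/
theorem lintegral_enorm_le_iterate {f : Euc n → ℝ} (hf : ContDiff ℝ ∞ f) (x₀ : Euc n)
    {R : ℝ} (hR : 0 < R) (k : ℕ) :
    ∫⁻ x in ball x₀ R, ‖f x‖ₑ ≤
      (∑ h ∈ Finset.range k, (2 * (ENNReal.ofReal (2 * R) * 2 ^ n)) ^ h *
        ∑ d : Fin h → Fin n, ‖∫ x in ball x₀ R, listD (List.ofFn d) f x‖ₑ) +
      (2 * (ENNReal.ofReal (2 * R) * 2 ^ n)) ^ k *
        ∑ d : Fin k → Fin n, ∫⁻ x in ball x₀ R, ‖listD (List.ofFn d) f x‖ₑ := by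
  induction k with
  | zero => simp
  | succ k ih =>
    refine ih.trans ?_
    rw [Finset.sum_range_succ, add_assoc]
    refine add_le_add le_rfl ?_
    rw [pow_succ, mul_assoc, ← mul_add]
    refine mul_le_mul' le_rfl ?_
    rw [sum_listD_ofFn_succ (fun l => ∫⁻ x in ball x₀ R, ‖listD l f x‖ₑ), Finset.mul_sum,
      ← Finset.sum_add_distrib]
    exact Finset.sum_le_sum fun d _ => lintegral_enorm_le_partialD (contDiff_listD hf _) x₀ hR

end Poincare

section Mollification

variable {n : ℕ} {ρ g u : Euc n → ℝ}

/-- The convolution `ρ ⋆ g` of real functions on Euclidean space. -/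
def moll (ρ g : Euc n → ℝ) : Euc n → ℝ :=
  convolution ρ g (ContinuousLinearMap.lsmul ℝ ℝ) volume

theorem moll_apply (ρ g : Euc n → ℝ) (x : Euc n) : moll ρ g x = ∫ t, ρ t * g (x - t) := rfl

theorem moll_apply_swap (ρ g : Euc n → ℝ) (x : Euc n) : moll ρ g x = ∫ t, ρ (x - t) * g t := by
  rw [moll, convolution_eq_swap]
  rfl

theorem contDiff_moll (hρ : ContDiff ℝ ∞ ρ) (hc : HasCompactSupport ρ)
    (hg : LocallyIntegrable g) : ContDiff ℝ ∞ (moll ρ g) :=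
  hc.contDiff_convolution_left _ hρ hg

theorem integrable_moll_integrand (hρ : Continuous ρ) (hc : HasCompactSupport ρ)
    (hg : LocallyIntegrable g) (x : Euc n) : Integrable fun t => ρ t * g (x - t) :=
  hc.convolutionExists_left (ContinuousLinearMap.lsmul ℝ ℝ) hρ hg x

theorem partialD_moll (hρ : ContDiff ℝ ∞ ρ) (hc : HasCompactSupport ρ)
    (hg : LocallyIntegrable g) (j : Fin n) :
    partialD j (moll ρ g) = moll (partialD j ρ) g := by
  funext x
  have h1 : ContDiff ℝ 1 ρ := hρ.of_le (by exact_mod_cast le_top)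
  have h := hc.hasFDerivAt_convolution_left (ContinuousLinearMap.lsmul ℝ ℝ) h1 hg x
  unfold partialD moll
  rw [h.fderiv, convolution, ContinuousLinearMap.integral_apply]
  · rfl
  · exact (hc.fderiv ℝ).convolutionExists_left _ (h1.continuous_fderiv (by simp)) hg x

theorem listD_moll (hρ : ContDiff ℝ ∞ ρ) (hc : HasCompactSupport ρ)
    (hg : LocallyIntegrable g) (l : List (Fin n)) :
    listD l (moll ρ g) = moll (listD l ρ) g := by
  induction l with
  | nil => rfl
  | cons j l ih =>
    rw [listD_cons, ih, partialD_moll (contDiff_listD hρ l) (hasCompactSupport_listD hc l) hg,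
      listD_cons]

/-- Mollification commutes with weak differentiation. -/
theorem listD_moll_of_weak (hρ : ContDiff ℝ ∞ ρ) (hc : HasCompactSupport ρ)
    (hu : LocallyIntegrable u) (l : List (Fin n))
    (hw : ∀ ψ : Euc n → ℝ, ContDiff ℝ ∞ ψ → HasCompactSupport ψ →
      ∫ x, u x * listD l ψ x = (-1) ^ l.length * ∫ x, g x * ψ x) :
    listD l (moll ρ u) = moll ρ g := by
  rw [listD_moll hρ hc hu]
  funext x
  have hψ : ContDiff ℝ ∞ fun y => ρ (x - y) := hρ.comp (contDiff_const.sub contDiff_id)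
  have hψc : HasCompactSupport fun y => ρ (x - y) :=
    hc.comp_homeomorph (Homeomorph.subLeft x)
  have h := hw _ hψ hψc
  rw [listD_comp_sub_left hρ] at h
  rw [moll_apply_swap, moll_apply_swap]
  have h2 : ∫ y, u y * ((-1) ^ l.length * listD l ρ (x - y)) =
      (-1) ^ l.length * ∫ y, listD l ρ (x - y) * u y := by
    rw [← integral_const_mul]
    congr 1; funext y; ring
  rw [h2] at h
  have h3 := mul_left_cancel₀ (pow_ne_zero _ (by norm_num)) h
  rw [h3]
  congr 1; funext y; ring

theorem moll_congr (h : g =ᵐ[volume] u) : moll ρ g = moll ρ u := by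
  funext x
  exact congrFun (convolution_congr _ (Filter.EventuallyEq.refl _ _) h) x

theorem enorm_moll_sub_le (hρ : Continuous ρ) (hc : HasCompactSupport ρ)
    (hg : LocallyIntegrable g) (hρ1 : ∫ t, ρ t = 1) (x : Euc n) :
    ‖moll ρ g x - g x‖ₑ ≤ ∫⁻ z, ‖ρ z‖ₑ * ‖g (x - z) - g x‖ₑ := by
  have h1 : moll ρ g x - g x = ∫ z, ρ z * (g (x - z) - g x) := by
    have hi := hρ.integrable_of_hasCompactSupport (μ := (volume : Measure (Euc n))) hc
    simp_rw [mul_sub]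
    rw [integral_sub (integrable_moll_integrand hρ hc hg x) (hi.mul_const _),
      integral_mul_const, hρ1, one_mul, moll_apply]
  rw [h1]
  refine (enorm_integral_le_lintegral_enorm _).trans_eq ?_
  simp_rw [enorm_mul]

theorem enorm_moll_sub_moll_le (hρ : Continuous ρ) (hc : HasCompactSupport ρ)
    (hg : LocallyIntegrable g) (x y : Euc n) :
    ‖moll ρ g x - moll ρ g y‖ₑ ≤ ∫⁻ z, ‖ρ z‖ₑ * ‖g (x - z) - g (y - z)‖ₑ := by
  rw [moll_apply, moll_apply, ← integral_sub (integrable_moll_integrand hρ hc hg x)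
    (integrable_moll_integrand hρ hc hg y)]
  refine (enorm_integral_le_lintegral_enorm _).trans_eq ?_
  simp_rw [← mul_sub, enorm_mul]

/-- Mollification does not increase double integrals of differences over balls. -/
theorem lintegral_lintegral_moll_sub_le (hρ : Continuous ρ) (hc : HasCompactSupport ρ)
    (hg : LocallyIntegrable g) (hρ1 : ∫⁻ t, ‖ρ t‖ₑ = 1) {R : ℝ} {M : ℝ≥0∞}
    (hM : ∀ x₀, ∫⁻ x in ball x₀ R, ∫⁻ y in ball x₀ R, ‖g x - g y‖ₑ ≤ M) (x₀ : Euc n) :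
    ∫⁻ x in ball x₀ R, ∫⁻ y in ball x₀ R, ‖moll ρ g x - moll ρ g y‖ₑ ≤ M := by
  wlog hgm : Measurable g generalizing g
  · have hae := hg.aestronglyMeasurable.ae_eq_mk
    have hl : LocallyIntegrable (hg.aestronglyMeasurable.mk g) := hg.congr hae
    rw [moll_congr hae]
    refine this hl ?_ hg.aestronglyMeasurable.stronglyMeasurable_mk.measurable
    intro x₁
    refine le_trans (le_of_eq ?_) (hM x₁)
    refine lintegral_congr_ae ?_
    filter_upwards [ae_restrict_of_ae hae] with x hx
    refine lintegral_congr_ae ?_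
    filter_upwards [ae_restrict_of_ae hae] with y hy
    rw [hx, hy]
  have hρm : Measurable ρ := hρ.measurable
  calc ∫⁻ x in ball x₀ R, ∫⁻ y in ball x₀ R, ‖moll ρ g x - moll ρ g y‖ₑ
      ≤ ∫⁻ x in ball x₀ R, ∫⁻ y in ball x₀ R, ∫⁻ z, ‖ρ z‖ₑ * ‖g (x - z) - g (y - z)‖ₑ :=
        lintegral_mono fun x => lintegral_mono fun y => enorm_moll_sub_moll_le hρ hc hg x y
    _ = ∫⁻ z, ‖ρ z‖ₑ * ∫⁻ x in ball x₀ R, ∫⁻ y in ball x₀ R, ‖g (x - z) - g (y - z)‖ₑ := by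
        have h1 : ∀ x, ∫⁻ y in ball x₀ R, ∫⁻ z, ‖ρ z‖ₑ * ‖g (x - z) - g (y - z)‖ₑ =
            ∫⁻ z, ∫⁻ y in ball x₀ R, ‖ρ z‖ₑ * ‖g (x - z) - g (y - z)‖ₑ := by
          intro x
          rw [lintegral_lintegral_swap]
          refine Measurable.aemeasurable ?_
          unfold Function.uncurry
          fun_prop
        simp_rw [h1]
        rw [lintegral_lintegral_swap]
        · simp_rw [lintegral_const_mul' _ _ enorm_ne_top]
        · refine Measurable.aemeasurable ?_
          exact Measurable.lintegral_prod_right'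
            (f := fun q : (Euc n × Euc n) × Euc n =>
              ‖ρ q.1.2‖ₑ * ‖g (q.1.1 - q.1.2) - g (q.2 - q.1.2)‖ₑ) (by fun_prop)
    _ ≤ ∫⁻ z, ‖ρ z‖ₑ * M := by
        gcongr with z
        have hpre : ball x₀ R = (fun x => x - z) ⁻¹' ball (x₀ - z) R := by
          ext x; simp [dist_eq_norm]
        have htr : ∀ F : Euc n → ℝ≥0∞, ∫⁻ x in ball x₀ R, F (x - z) =
            ∫⁻ x in ball (x₀ - z) R, F x := by
          intro F
          rw [hpre]
          exact (measurePreserving_sub_right volume z).setLIntegral_comp_preimage_emb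
            (measurableEmbedding_subRight z) F _
        have h2 : ∀ x, ∫⁻ y in ball x₀ R, ‖g (x - z) - g (y - z)‖ₑ =
            ∫⁻ y in ball (x₀ - z) R, ‖g (x - z) - g y‖ₑ :=
          fun x => htr fun y => ‖g (x - z) - g y‖ₑ
        simp_rw [h2]
        rw [htr fun x => ∫⁻ y in ball (x₀ - z) R, ‖g x - g y‖ₑ]
        exact hM _
    _ = M := by
        rw [lintegral_mul_const _ (by fun_prop), hρ1, one_mul]

end Mollification

section MollificationLimit

variable {n : ℕ} {g : Euc n → ℝ}

/-- Continuity of translations in `L¹` on balls. -/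
theorem exists_translation_lintegral_le (hg : LocallyIntegrable g) (hgm : Measurable g)
    (x₀ : Euc n) (R : ℝ) {ε : ℝ≥0∞} (hε : ε ≠ 0) :
    ∃ δ : ℝ, 0 < δ ∧ ∀ z : Euc n, ‖z‖ < δ → ∫⁻ x in ball x₀ R, ‖g (x - z) - g x‖ₑ ≤ ε := by
  have hε3 : ε / 3 ≠ 0 := by simp [hε]
  set G := (closedBall x₀ (R + 1)).indicator g with hG
  have hGi : Integrable G :=
    (integrable_indicator_iff isClosed_closedBall.measurableSet).2
      (hg.integrableOn_isCompact (isCompact_closedBall _ _))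
  have hGm : Measurable G := hgm.indicator isClosed_closedBall.measurableSet
  obtain ⟨h, hc, hle, hcont, -⟩ := hGi.exists_hasCompactSupport_lintegral_sub_le hε3
  obtain ⟨η, hη, hηlt⟩ := ENNReal.exists_nnreal_pos_mul_lt
    (measure_ball_lt_top (μ := volume) (x := x₀) (r := R)).ne hε3
  obtain ⟨δ, hδ, hu⟩ := Metric.uniformContinuous_iff.1
    (hc.uniformContinuous_of_continuous hcont) η hη
  refine ⟨min δ 1, by positivity, fun z hz => ?_⟩
  have hz1 : ‖z‖ < δ := hz.trans_le (min_le_left _ _)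
  have hz2 : ‖z‖ < 1 := hz.trans_le (min_le_right _ _)
  have hhm : Measurable h := hcont.measurable
  calc ∫⁻ x in ball x₀ R, ‖g (x - z) - g x‖ₑ
      ≤ ∫⁻ x in ball x₀ R, (‖G (x - z) - h (x - z)‖ₑ + (‖G x - h x‖ₑ + η)) := by
        refine setLIntegral_mono' measurableSet_ball fun x hx => ?_
        rw [mem_ball, dist_eq_norm] at hx
        have e1 : g x = G x := by
          rw [hG, indicator_of_mem]
          rw [mem_closedBall, dist_eq_norm]; linarith
        have e2 : g (x - z) = G (x - z) := by
          rw [hG, indicator_of_mem]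
          rw [mem_closedBall, dist_eq_norm, sub_right_comm]
          have := norm_sub_le (x - x₀) z
          linarith
        have e3 : ‖h (x - z) - h x‖ₑ ≤ η := by
          rw [enorm_le_coe, ← NNReal.coe_le_coe, coe_nnnorm, ← dist_eq_norm]
          refine (hu ?_).le
          simpa [dist_eq_norm] using hz1
        rw [e1, e2]
        have e4 : G (x - z) - G x = (G (x - z) - h (x - z)) - (G x - h x) +
          (h (x - z) - h x) := by ring
        rw [e4, ← add_assoc]
        exact (enorm_add_le _ _).trans (add_le_add enorm_sub_le e3)
    _ = (∫⁻ x in ball x₀ R, ‖G (x - z) - h (x - z)‖ₑ) + ((∫⁻ x in ball x₀ R, ‖G x - h x‖ₑ) +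
          η * volume (ball x₀ R)) := by
        rw [lintegral_add_left (by fun_prop), lintegral_add_left (by fun_prop),
          setLIntegral_const]
    _ ≤ ε / 3 + (ε / 3 + ε / 3) := by
        refine add_le_add ?_ (add_le_add ((setLIntegral_le_lintegral _ _).trans hle) hηlt.le)
        refine (setLIntegral_le_lintegral _ _).trans ?_
        rw [lintegral_sub_right_eq_self fun x => ‖G x - h x‖ₑ]
        exact hle
    _ = ε := by rw [← add_assoc, ENNReal.add_thirds]

theorem exists_lintegral_moll_sub_le (hg : LocallyIntegrable g) (x₀ : Euc n) (R : ℝ)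
    {ε : ℝ≥0∞} (hε : ε ≠ 0) :
    ∃ δ : ℝ, 0 < δ ∧ ∀ ρ : Euc n → ℝ, Continuous ρ → HasCompactSupport ρ →
      ∫ t, ρ t = 1 → ∫⁻ t, ‖ρ t‖ₑ = 1 → Function.support ρ ⊆ ball 0 δ →
      ∫⁻ x in ball x₀ R, ‖moll ρ g x - g x‖ₑ ≤ ε := by
  wlog hgm : Measurable g generalizing g
  · have hae := hg.aestronglyMeasurable.ae_eq_mk
    obtain ⟨δ, hδ, h⟩ := this (hg.congr hae)
      hg.aestronglyMeasurable.stronglyMeasurable_mk.measurable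
    refine ⟨δ, hδ, fun ρ h1 h2 h3 h4 h5 => le_trans (le_of_eq ?_) (h ρ h1 h2 h3 h4 h5)⟩
    rw [moll_congr hae]
    refine lintegral_congr_ae ?_
    filter_upwards [ae_restrict_of_ae hae] with x hx
    rw [hx]
  obtain ⟨δ, hδ, h⟩ := exists_translation_lintegral_le hg hgm x₀ R hε
  refine ⟨δ, hδ, fun ρ hρ hc h3 h4 hs => ?_⟩
  have hρm : Measurable ρ := hρ.measurable
  calc ∫⁻ x in ball x₀ R, ‖moll ρ g x - g x‖ₑ
      ≤ ∫⁻ x in ball x₀ R, ∫⁻ z, ‖ρ z‖ₑ * ‖g (x - z) - g x‖ₑ :=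
        lintegral_mono fun x => enorm_moll_sub_le hρ hc hg h3 x
    _ = ∫⁻ z, ‖ρ z‖ₑ * ∫⁻ x in ball x₀ R, ‖g (x - z) - g x‖ₑ := by
        rw [lintegral_lintegral_swap]
        · simp_rw [lintegral_const_mul' _ _ enorm_ne_top]
        · refine Measurable.aemeasurable ?_
          unfold Function.uncurry
          fun_prop
    _ ≤ ∫⁻ z, ‖ρ z‖ₑ * ε := by
        refine lintegral_mono fun z => ?_
        by_cases hz : ρ z = 0
        · simp [hz]
        · exact mul_le_mul' le_rfl (h z (mem_ball_zero_iff.1 (hs hz)))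
    _ = ε := by rw [lintegral_mul_const _ (by fun_prop), h4, one_mul]

/-- A sequence of normalized smooth bump functions with shrinking supports. -/
def bumpSeq (n : ℕ) (i : ℕ) : Euc n → ℝ :=
  (⟨1 / (2 * ((i : ℝ) + 1)), 1 / ((i : ℝ) + 1), by positivity, by
    gcongr; linarith [(by positivity : (0 : ℝ) < (i : ℝ) + 1)]⟩ :
    ContDiffBump (0 : Euc n)).normed volume

theorem contDiff_bumpSeq (i : ℕ) : ContDiff ℝ ∞ (bumpSeq n i) := ContDiffBump.contDiff_normed _

theorem hasCompactSupport_bumpSeq (i : ℕ) : HasCompactSupport (bumpSeq n i) :=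
  ContDiffBump.hasCompactSupport_normed _

theorem integral_bumpSeq (i : ℕ) : ∫ t, bumpSeq n i t = 1 := ContDiffBump.integral_normed _

theorem lintegral_enorm_bumpSeq (i : ℕ) : ∫⁻ t, ‖bumpSeq n i t‖ₑ = 1 := by
  have h0 : ∀ t, 0 ≤ bumpSeq n i t := fun t => ContDiffBump.nonneg_normed _ t
  simp_rw [fun t => Real.enorm_eq_ofReal (h0 t)]
  rw [← ofReal_integral_eq_lintegral_ofReal _ (ae_of_all _ h0), integral_bumpSeq,
    ENNReal.ofReal_one]
  exact (contDiff_bumpSeq i).continuous.integrable_of_hasCompactSupport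
    (hasCompactSupport_bumpSeq i)

theorem support_bumpSeq (i : ℕ) :
    Function.support (bumpSeq n i) = ball 0 (1 / ((i : ℝ) + 1)) :=
  ContDiffBump.support_normed_eq _

/-- Mollifications converge in `L¹` on balls. -/
theorem tendsto_lintegral_moll_sub (hg : LocallyIntegrable g) (x₀ : Euc n) (R : ℝ) :
    Tendsto (fun i => ∫⁻ x in ball x₀ R, ‖moll (bumpSeq n i) g x - g x‖ₑ) atTop (𝓝 0) := by
  rw [ENNReal.tendsto_nhds_zero]
  intro ε hε
  obtain ⟨δ, hδ, h⟩ := exists_lintegral_moll_sub_le hg x₀ R hε.ne'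
  filter_upwards [(tendsto_one_div_add_atTop_nhds_zero_nat (𝕜 := ℝ)).eventually_lt_const hδ]
    with i hi
  refine h _ (contDiff_bumpSeq i).continuous (hasCompactSupport_bumpSeq i) (integral_bumpSeq i)
    (lintegral_enorm_bumpSeq i) ?_
  rw [support_bumpSeq]
  exact ball_subset_ball hi.le

end MollificationLimit

section CampanatoPolynomial

variable {n k : ℕ} {u : Euc n → ℝ} {D : (h : ℕ) → Euc n → (Fin h → Fin n) → ℝ}

theorem weakDeriv_get_ofFn (D : (h : ℕ) → Euc n → (Fin h → Fin n) → ℝ) {h : ℕ}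
    (d : Fin h → Fin n) (x : Euc n) :
    D (List.ofFn d).length x (List.ofFn d).get = D h x d :=
  congrArg (fun p : Σ h, Fin h → Fin n => D p.1 x p.2)
    (List.equivSigmaTuple.right_inv ⟨h, d⟩)

theorem HasWeakDerivs.locallyIntegrable (hD : HasWeakDerivs n k u D) : LocallyIntegrable u := by
  have h := (hD.2 0 (Nat.zero_le k) Fin.elim0).1
  simpa only [hD.1] using h

theorem HasWeakDerivs.integral_mul_listD (hD : HasWeakDerivs n k u D) {h : ℕ} (hh : h ≤ k)
    (d : Fin h → Fin n) {ψ : Euc n → ℝ} (hψ : ContDiff ℝ ∞ ψ) (hc : HasCompactSupport ψ) :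
    ∫ x, u x * listD (List.ofFn d) ψ x = (-1) ^ h * ∫ x, D h x d * ψ x := by
  rw [← (hD.2 h hh d).2 ψ hψ hc]
  simp_rw [iteratedFDeriv_single_eq_listD hψ h d]

/-- Weak derivatives do not depend on the order of differentiation. -/
theorem HasWeakDerivs.ae_eq_of_perm (hD : HasWeakDerivs n k u D) {l l' : List (Fin n)}
    (hl : l.Perm l') (hk : l.length ≤ k) :
    ∀ᵐ x, D l.length x l.get = D l'.length x l'.get := by
  have hk' : l'.length ≤ k := hl.length_eq ▸ hk
  refine ae_eq_of_integral_contDiff_smul_eq (hD.2 _ hk _).1 (hD.2 _ hk' _).1 fun ψ hψ hc => ?_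
  have h1 := hD.integral_mul_listD hk l.get hψ hc
  have h2 := hD.integral_mul_listD hk' l'.get hψ hc
  rw [List.ofFn_get] at h1 h2
  have hsign : (-1 : ℝ) ^ l'.length = (-1) ^ l.length := by rw [hl.length_eq]
  rw [listD_perm hψ hl, h2, hsign] at h1
  simp_rw [smul_eq_mul, mul_comm (ψ _)]
  have := mul_left_cancel₀ (pow_ne_zero _ (by norm_num)) h1
  exact this.symm

theorem HasWeakDerivs.exists_isCampPoly (hD : HasWeakDerivs n k u D) (x₀ : Euc n) {R : ℝ}
    (hR : 0 < R) : ∃ P, IsCampPoly n k D (ball x₀ R) P := by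
  obtain ⟨P, hP, h_int⟩ := exists_polynomial_setIntegral_eq (B := ball x₀ R)
    (measure_ball_pos _ _ hR).ne' isBounded_ball k
    (fun l => ∫ x in ball x₀ R, D l.length x l.get) (fun l l' hl hk =>
      integral_congr_ae (ae_restrict_of_ae (hD.ae_eq_of_perm hl hk)))
  refine ⟨P, hP, fun h hh d => ?_⟩
  have h1 := h_int (List.ofFn d) (by simpa using hh)
  simp_rw [weakDeriv_get_ofFn D d] at h1
  rw [← h1]
  refine integral_congr_ae (ae_of_all _ fun x => ?_)
  exact (iteratedFDeriv_single_eq_listD (contDiff_polyFun P) h d x).symm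

theorem IsCampPoly.setIntegral_eq {B : Set (Euc n)} {P : MvPolynomial (Fin n) ℝ}
    (hP : IsCampPoly n k D B P) {h : ℕ} (hh : h ≤ k) (d : Fin h → Fin n) :
    ∫ x in B, D h x d = ∫ x in B, listD (List.ofFn d) (polyFun P) x := by
  rw [hP.2 h hh d]
  exact integral_congr_ae (ae_of_all _ fun x =>
    iteratedFDeriv_single_eq_listD (contDiff_polyFun P) h d x)

/-- The distance of `u` to its projection polynomial is controlled by the oscillation of the
weak derivatives of top order. -/
theorem HasWeakDerivs.lintegral_sub_polyFun_le (hD : HasWeakDerivs n k u D) (x₀ : Euc n) {R : ℝ}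
    (hR : 0 < R) {M : ℝ≥0∞}
    (hM : ∀ (d : Fin k → Fin n) (x₁ : Euc n),
      ∫⁻ x in ball x₁ R, ∫⁻ y in ball x₁ R, ‖D k x d - D k y d‖ₑ ≤ M)
    {P : MvPolynomial (Fin n) ℝ} (hP : IsCampPoly n k D (ball x₀ R) P) :
    ∫⁻ x in ball x₀ R, ‖u x - polyFun P x‖ₑ ≤
      (2 * (ENNReal.ofReal (2 * R) * 2 ^ n)) ^ k *
        (n ^ k * ((volume (ball x₀ R))⁻¹ * M)) := by
  set B := ball x₀ R with hB
  set K : ℝ≥0∞ := 2 * (ENNReal.ofReal (2 * R) * 2 ^ n) with hK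
  have hKtop : K ≠ ⊤ := by finiteness
  have hV0 : volume B ≠ 0 := (measure_ball_pos _ _ hR).ne'
  have hV : volume B ≠ ⊤ := measure_ball_lt_top.ne
  have hu := hD.locallyIntegrable
  have hcontB : ∀ {f : Euc n → ℝ}, Continuous f → IntegrableOn f B := fun hf =>
    (hf.continuousOn.integrableOn_compact (isCompact_closedBall x₀ R)).mono_set
      ball_subset_closedBall
  set δ : (Euc n → ℝ) → ℕ → ℝ≥0∞ := fun g i => ∫⁻ x in B, ‖moll (bumpSeq n i) g x - g x‖ₑ
    with hδ
  have hδlim : ∀ {g}, LocallyIntegrable g → Tendsto (δ g) atTop (𝓝 0) := fun hg =>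
    tendsto_lintegral_moll_sub hg x₀ R
  set f : ℕ → Euc n → ℝ := fun i x => moll (bumpSeq n i) u x - polyFun P x with hf
  have hmollC : ∀ {g} i, LocallyIntegrable g → ContDiff ℝ ∞ (moll (bumpSeq n i) g) :=
    fun i hg => contDiff_moll (contDiff_bumpSeq i) (hasCompactSupport_bumpSeq i) hg
  have hfC : ∀ i, ContDiff ℝ ∞ (f i) := fun i => (hmollC i hu).sub (contDiff_polyFun P)
  have hlist : ∀ {h} (_ : h ≤ k) (d : Fin h → Fin n) i, listD (List.ofFn d) (f i) =
      fun x => moll (bumpSeq n i) (fun x => D h x d) x - listD (List.ofFn d) (polyFun P) x := by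
    intro h hh d i
    rw [hf, listD_sub (hmollC i hu) (contDiff_polyFun P),
      listD_moll_of_weak (g := fun x => D h x d) (contDiff_bumpSeq i)
        (hasCompactSupport_bumpSeq i) hu]
    intro ψ hψ hc
    rw [List.length_ofFn]
    exact hD.integral_mul_listD hh d hψ hc
  have hmean : ∀ {h} (_ : h ≤ k) (d : Fin h → Fin n) i,
      ‖∫ x in B, listD (List.ofFn d) (f i) x‖ₑ ≤ δ (fun x => D h x d) i := by
    intro h hh d i
    have hloc := (hD.2 h hh d).1
    rw [hlist hh d i, integral_sub (hcontB (hmollC i hloc).continuous)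
      (hcontB (contDiff_listD (contDiff_polyFun P) _).continuous), ← hP.setIntegral_eq hh d,
      ← integral_sub (hcontB (hmollC i hloc).continuous)
        ((hloc.integrableOn_isCompact (isCompact_closedBall x₀ R)).mono_set
          ball_subset_closedBall)]
    exact enorm_integral_le_lintegral_enorm _
  have htop : ∀ (d : Fin k → Fin n) i, ∫⁻ x in B, ‖listD (List.ofFn d) (f i) x‖ₑ ≤
      δ (fun x => D k x d) i + (volume B)⁻¹ * M := by
    intro d i
    refine (lintegral_enorm_le_mean_add hV0 hV
      (hcontB (contDiff_listD (hfC i) _).continuous)).trans ?_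
    refine add_le_add (hmean le_rfl d i) (mul_le_mul' le_rfl ?_)
    refine le_trans (le_of_eq ?_) (lintegral_lintegral_moll_sub_le
      (contDiff_bumpSeq i).continuous (hasCompactSupport_bumpSeq i) (hD.2 k le_rfl d).1
      (lintegral_enorm_bumpSeq i) (hM d) x₀)
    refine lintegral_congr fun x => lintegral_congr fun y => ?_
    rw [hlist le_rfl d i]
    have := listD_polyFun_eq_const (P := P) (List.ofFn d) (by simpa using hP.1) x y
    simp only [this, sub_sub_sub_cancel_right]
  have hbound : ∀ i, ∫⁻ x in B, ‖u x - polyFun P x‖ₑ ≤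
      δ u i + ((∑ h ∈ Finset.range k, K ^ h * ∑ d : Fin h → Fin n, δ (fun x => D h x d) i) +
        K ^ k * ∑ d : Fin k → Fin n, (δ (fun x => D k x d) i + (volume B)⁻¹ * M)) := by
    intro i
    calc ∫⁻ x in B, ‖u x - polyFun P x‖ₑ
        ≤ ∫⁻ x in B, (‖moll (bumpSeq n i) u x - u x‖ₑ + ‖f i x‖ₑ) := by
          refine lintegral_mono fun x => ?_
          have : u x - polyFun P x = f i x - (moll (bumpSeq n i) u x - u x) := by
            simp only [hf]; ring
          rw [this, add_comm]
          exact enorm_sub_le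
      _ = δ u i + ∫⁻ x in B, ‖f i x‖ₑ := by
          rw [lintegral_add_right _ (hfC i).continuous.enorm.measurable]
      _ ≤ _ := by
          refine add_le_add le_rfl ((lintegral_enorm_le_iterate (hfC i) x₀ hR k).trans ?_)
          gcongr with h hh d _ d _
          · exact hmean (Finset.mem_range.1 hh).le d i
          · exact htop d i
  refine ge_of_tendsto' (x := atTop) (f := fun i => δ u i + ((∑ h ∈ Finset.range k, K ^ h *
    ∑ d : Fin h → Fin n, δ (fun x => D h x d) i) +
        K ^ k * ∑ d : Fin k → Fin n, (δ (fun x => D k x d) i + (volume B)⁻¹ * M))) ?_ hbound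
  have h1 : Tendsto (fun i => ∑ h ∈ Finset.range k, K ^ h *
      ∑ d : Fin h → Fin n, δ (fun x => D h x d) i) atTop
      (𝓝 (∑ h ∈ Finset.range k, K ^ h * ∑ _d : Fin h → Fin n, 0)) := by
    refine tendsto_finsetSum _ fun h hh => ENNReal.Tendsto.const_mul ?_
      (Or.inr (ENNReal.pow_ne_top hKtop))
    exact tendsto_finsetSum _ fun d _ => hδlim (hD.2 h (Finset.mem_range.1 hh).le d).1
  have h2 : Tendsto (fun i => K ^ k * ∑ d : Fin k → Fin n,
      (δ (fun x => D k x d) i + (volume B)⁻¹ * M)) atTop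
      (𝓝 (K ^ k * ∑ _d : Fin k → Fin n, (0 + (volume B)⁻¹ * M))) := by
    refine ENNReal.Tendsto.const_mul ?_ (Or.inr (ENNReal.pow_ne_top hKtop))
    exact tendsto_finsetSum _ fun d _ => (hδlim (hD.2 k le_rfl d).1).add tendsto_const_nhds
  have h3 := (hδlim hu).add (h1.add h2)
  convert h3 using 2
  simp

end CampanatoPolynomial

section YoungFunctions

variable {A : ℝ → ℝ≥0∞}

theorem IsYoung.le_mul (hA : IsYoung A) {a b : ℝ} (ha : 0 ≤ a) (hab : a ≤ b) (hb : 0 < b) :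
    A a ≤ ENNReal.ofReal (a / b) * A b := by
  have h := hA.2.1 b 0 (a / b) hb.le le_rfl (by positivity) (div_le_one_of_le₀ hab hb.le)
  rwa [mul_zero, add_zero, div_mul_cancel₀ _ hb.ne', hA.1, mul_zero, add_zero] at h

theorem IsYoung.mono_s14 (hA : IsYoung A) {a b : ℝ} (ha : 0 ≤ a) (hab : a ≤ b) : A a ≤ A b := by
  rcases hab.eq_or_lt with rfl | hlt
  · exact le_rfl
  have hb : 0 < b := ha.trans_lt hlt
  refine (hA.le_mul ha hab hb).trans (mul_le_of_le_one_left' ?_)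
  exact ENNReal.ofReal_le_one.2 (div_le_one_of_le₀ hab hb.le)

theorem IsYoung.exists_lt (hA : IsYoung A) {v : ℝ≥0∞} (hv : v ≠ ⊤) : ∃ τ, 0 ≤ τ ∧ v < A τ := by
  by_contra! hcon
  obtain ⟨t, ht, hAt⟩ : ∃ t, 0 < t ∧ A t ≠ 0 := by
    obtain ⟨t₁, t₂, h1, h2, hne⟩ := hA.2.2.2
    by_contra! hz
    exact hne (by rw [hz t₁ h1, hz t₂ h2])
  refine hAt (le_antisymm ?_ zero_le)
  have hlim : Tendsto (fun i : ℕ => ENNReal.ofReal (1 / ((i : ℝ) + 1)) * v) atTop (𝓝 0) := by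
    have h := ENNReal.tendsto_ofReal (tendsto_one_div_add_atTop_nhds_zero_nat (𝕜 := ℝ))
    have h2 := ENNReal.Tendsto.mul_const h (Or.inr hv)
    simpa using h2
  refine ge_of_tendsto' hlim fun i => ?_
  have hi : (0 : ℝ) < (i : ℝ) + 1 := by positivity
  have hle : t ≤ ((i : ℝ) + 1) * t := by nlinarith [(Nat.cast_nonneg i : (0 : ℝ) ≤ i)]
  refine (hA.le_mul ht.le hle (by positivity)).trans ?_
  have heq : t / (((i : ℝ) + 1) * t) = 1 / ((i : ℝ) + 1) := by field_simp
  rw [heq]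
  exact mul_le_mul' le_rfl (hcon _ (by positivity))

theorem IsYoung.rcInv_pos (hA : IsYoung A) {v : ℝ≥0∞} (hv0 : v ≠ 0) (hv : v ≠ ⊤) :
    0 < rcInv A v := by
  obtain ⟨t, ht, hAt⟩ : ∃ t, 0 < t ∧ A t ≠ ⊤ := by
    obtain ⟨t₁, t₂, h1, h2, hne⟩ := hA.2.2.2
    by_contra! hz
    exact hne (by rw [hz t₁ h1, hz t₂ h2])
  obtain ⟨η, hη, hlt⟩ := ENNReal.exists_nnreal_pos_mul_lt hAt hv0
  set b : ℝ := min (η : ℝ) 1 * t with hb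
  have hb0 : 0 < b := by positivity
  have hbt : b ≤ t := mul_le_of_le_one_left ht.le (min_le_right _ _)
  have hAb : A b ≤ v := by
    refine (hA.le_mul hb0.le hbt ht).trans (le_trans (mul_le_mul' ?_ le_rfl) hlt.le)
    rw [hb, mul_div_cancel_right₀ _ ht.ne', ← ENNReal.ofReal_coe_nnreal]
    exact ENNReal.ofReal_le_ofReal (min_le_left _ _)
  refine hb0.trans_le (le_csInf (hA.exists_lt hv) fun τ hτ => ?_)
  by_contra! hlt'
  exact (hτ.2.trans_le ((hA.mono_s14 hτ.1 hlt'.le).trans hAb)).false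

theorem IsYoung.lt_of_rcInv_lt (hA : IsYoung A) {v : ℝ≥0∞} (hv : v ≠ ⊤) {τ : ℝ}
    (hτ : rcInv A v < τ) : v < A τ := by
  obtain ⟨τ', hτ', hlt⟩ := exists_lt_of_csInf_lt (hA.exists_lt hv) hτ
  exact hτ'.2.trans_le (hA.mono_s14 hτ'.1 hlt.le)

theorem IsYoung.ofReal_le (hA : IsYoung A) {v : ℝ≥0∞} (hv0 : v ≠ 0) (hv : v ≠ ⊤) {t : ℝ}
    (ht : 0 ≤ t) :
    ENNReal.ofReal t ≤ ENNReal.ofReal (2 * rcInv A v) * (1 + v⁻¹ * A t) := by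
  have hpos := hA.rcInv_pos hv0 hv
  set τ := 2 * rcInv A v with hτ
  have hτ0 : 0 < τ := by positivity
  rcases le_total t τ with h | h
  · refine (ENNReal.ofReal_le_ofReal h).trans ?_
    exact le_mul_of_one_le_right zero_le le_self_add
  · have htpos : 0 < t := hτ0.trans_le h
    have h1 : v ≤ ENNReal.ofReal (τ / t) * A t :=
      (hA.lt_of_rcInv_lt hv (by linarith)).le.trans (hA.le_mul hτ0.le h htpos)
    have h2 : ENNReal.ofReal t * v ≤ ENNReal.ofReal τ * A t := by
      refine (mul_le_mul' le_rfl h1).trans_eq ?_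
      rw [← mul_assoc, ← ENNReal.ofReal_mul ht, mul_div_cancel₀ _ htpos.ne']
    calc ENNReal.ofReal t ≤ ENNReal.ofReal τ * A t / v := by
          rwa [ENNReal.le_div_iff_mul_le (Or.inl hv0) (Or.inl hv)]
      _ = ENNReal.ofReal τ * (v⁻¹ * A t) := by rw [div_eq_mul_inv]; ring
      _ ≤ _ := mul_le_mul' le_rfl le_add_self

/-- A bound for the functional `Jfun` controls the oscillation over balls. -/
theorem lintegral_lintegral_le_of_Jfun_le_one {n : ℕ} {ι : Type} [Fintype ι] {σ : ℝ}
    (hA : IsYoung A) (hσ : 0 ≤ σ) {v : Euc n → ι → ℝ} {lam : ℝ} (hlam : 0 < lam)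
    (hJ : Jfun n σ A (fun x i => v x i / lam) ≤ 1) {w : ℝ≥0∞} (hw0 : w ≠ 0) (hw : w ≠ ⊤)
    (i : ι) (x₀ : Euc n) {R : ℝ} (hR : 0 < R) :
    ∫⁻ x in ball x₀ R, ∫⁻ y in ball x₀ R, ‖v x i - v y i‖ₑ ≤
      ENNReal.ofReal (lam * (2 * R) ^ σ) * (ENNReal.ofReal (2 * rcInv A w) *
        (volume (ball x₀ R) * volume (ball x₀ R) +
          w⁻¹ * ENNReal.ofReal ((2 * R) ^ (n : ℝ)))) := by
  set B := ball x₀ R with hB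
  set t : Euc n → Euc n → ℝ := fun x y =>
    Real.sqrt (∑ i, (v x i / lam - v y i / lam) ^ 2) / ‖x - y‖ ^ σ with htdef
  set q : Euc n → Euc n → ℝ≥0∞ := fun x y =>
    A (t x y) / ENNReal.ofReal (‖x - y‖ ^ (n : ℝ)) with hq
  have ht0 : ∀ x y, 0 ≤ t x y := fun x y => by positivity
  have hdist : ∀ x ∈ B, ∀ y ∈ B, ‖x - y‖ ≤ 2 * R := by
    intro x hx y hy
    rw [← dist_eq_norm]
    have := dist_triangle_right x y x₀
    rw [hB, mem_ball] at hx hy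
    linarith
  have hdiff : ∀ x ∈ B, ∀ y ∈ B, ‖v x i - v y i‖ₑ ≤
      ENNReal.ofReal (lam * (2 * R) ^ σ) * ENNReal.ofReal (t x y) := by
    intro x hx y hy
    rcases eq_or_ne x y with rfl | hne
    · simp
    have hpos : 0 < ‖x - y‖ := norm_pos_iff.2 (sub_ne_zero.2 hne)
    have hs : |v x i / lam - v y i / lam| ≤
        Real.sqrt (∑ i, (v x i / lam - v y i / lam) ^ 2) := by
      refine Real.abs_le_sqrt ?_
      exact Finset.single_le_sum (f := fun i => (v x i / lam - v y i / lam) ^ 2)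
        (fun _ _ => sq_nonneg _) (Finset.mem_univ i)
    rw [← ENNReal.ofReal_mul (by positivity), ← ofReal_norm]
    refine ENNReal.ofReal_le_ofReal ?_
    have h1 : Real.sqrt (∑ i, (v x i / lam - v y i / lam) ^ 2) = t x y * ‖x - y‖ ^ σ := by
      rw [htdef]; field_simp
    have h2 : ‖v x i - v y i‖ = lam * |v x i / lam - v y i / lam| := by
      rw [← sub_div, abs_div, abs_of_pos hlam, Real.norm_eq_abs]; field_simp
    rw [h2]
    calc lam * |v x i / lam - v y i / lam| ≤ lam * (t x y * (2 * R) ^ σ) := by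
          refine mul_le_mul_of_nonneg_left (hs.trans (h1.le.trans ?_)) hlam.le
          exact mul_le_mul_of_nonneg_left
            (Real.rpow_le_rpow hpos.le (hdist x hx y hy) hσ) (ht0 x y)
      _ = _ := by ring
  have hAq : ∀ x ∈ B, ∀ y ∈ B, A (t x y) ≤ ENNReal.ofReal ((2 * R) ^ (n : ℝ)) * q x y := by
    intro x hx y hy
    rcases eq_or_ne x y with rfl | hne
    · simp [htdef, hA.1]
    have hpos : 0 < ‖x - y‖ := norm_pos_iff.2 (sub_ne_zero.2 hne)
    have h1 : A (t x y) = ENNReal.ofReal (‖x - y‖ ^ (n : ℝ)) * q x y := by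
      rw [hq, ENNReal.mul_div_cancel (by positivity) ENNReal.ofReal_ne_top]
    rw [h1]
    refine mul_le_mul' (ENNReal.ofReal_le_ofReal ?_) le_rfl
    exact Real.rpow_le_rpow hpos.le (hdist x hx y hy) (Nat.cast_nonneg n)
  have hwinv : w⁻¹ ≠ ⊤ := ENNReal.inv_ne_top.2 hw0
  calc ∫⁻ x in B, ∫⁻ y in B, ‖v x i - v y i‖ₑ
      ≤ ∫⁻ x in B, ∫⁻ y in B, ENNReal.ofReal (lam * (2 * R) ^ σ) *
          (ENNReal.ofReal (2 * rcInv A w) *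
            (1 + w⁻¹ * (ENNReal.ofReal ((2 * R) ^ (n : ℝ)) * q x y))) := by
        refine setLIntegral_mono' measurableSet_ball fun x hx =>
          setLIntegral_mono' measurableSet_ball fun y hy => ?_
        refine (hdiff x hx y hy).trans (mul_le_mul' le_rfl ?_)
        refine (hA.ofReal_le hw0 hw (ht0 x y)).trans ?_
        gcongr
        exact hAq x hx y hy
    _ = ENNReal.ofReal (lam * (2 * R) ^ σ) * (ENNReal.ofReal (2 * rcInv A w) *
          (volume B * volume B + w⁻¹ * (ENNReal.ofReal ((2 * R) ^ (n : ℝ)) *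
            ∫⁻ x in B, ∫⁻ y in B, q x y))) := by
        simp_rw [lintegral_const_mul' _ _ ENNReal.ofReal_ne_top,
          lintegral_add_left measurable_const, lintegral_const_mul' _ _ hwinv,
          lintegral_const_mul' _ _ ENNReal.ofReal_ne_top, setLIntegral_const, one_mul]
    _ ≤ _ := by
        gcongr
        refine mul_le_of_le_one_right' ?_
        refine le_trans ?_ hJ
        exact (setLIntegral_le_lintegral _ _).trans
          (lintegral_mono fun x => setLIntegral_le_lintegral _ _)

end YoungFunctions

section CampanatoBound

/-- The constant in the Campanato embedding. -/
def campConst (n k : ℕ) (σ : ℝ) : ℝ :=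
  (4 * 2 ^ n * n) ^ k * 2 ^ σ * 2 *
    (1 + 2 ^ n / (volume (ball (0 : Euc n) 1)).toReal) /
      ((volume (ball (0 : Euc n) 1)).toReal ^ (σ / n) *
        (volume (ball (0 : Euc n) 1)).toReal ^ ((k : ℝ) / n))

theorem toReal_volume_unitBall_pos (n : ℕ) : 0 < (volume (ball (0 : Euc n) 1)).toReal :=
  ENNReal.toReal_pos (measure_ball_pos _ _ one_pos).ne' measure_ball_lt_top.ne

theorem campConst_pos {n : ℕ} (hn : 0 < n) (k : ℕ) (σ : ℝ) : 0 < campConst n k σ := by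
  have := toReal_volume_unitBall_pos n
  unfold campConst
  positivity

theorem toReal_volume_ball (n : ℕ) (x : Euc n) {R : ℝ} (hR : 0 < R) :
    (volume (ball x R)).toReal = (volume (ball (0 : Euc n) 1)).toReal * R ^ n := by
  rw [Measure.addHaar_ball_of_pos volume x hR, ENNReal.toReal_mul, finrank_euclideanSpace_fin,
    ENNReal.toReal_ofReal (by positivity), mul_comm]

theorem campConst_mul_eq {n : ℕ} (hn : 0 < n) (k : ℕ) (σ : ℝ) {κ R τ W : ℝ} (lam : ℝ)
    (hκ : κ = (volume (ball (0 : Euc n) 1)).toReal) (hR : 0 < R) (hτ : 0 < τ)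
    (hW : W = κ * R ^ n) :
    ((W ^ ((n : ℝ)⁻¹)) ^ σ * τ * W ^ ((k : ℝ) / n))⁻¹ * W⁻¹ *
      ((2 * (2 * R * 2 ^ n)) ^ k * (n ^ k * (W⁻¹ * (lam * (2 * R) ^ σ *
        (2 * τ * (W * W + W * (2 * R) ^ (n : ℝ))))))) = campConst n k σ * lam := by
  have hκ0 : 0 < κ := hκ ▸ toReal_volume_unitBall_pos n
  have hn' : (n : ℝ) ≠ 0 := by positivity
  have hW0 : 0 < W := by rw [hW]; positivity
  have e1 : (W ^ ((n : ℝ)⁻¹)) ^ σ = κ ^ (σ / n) * R ^ σ := by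
    rw [← Real.rpow_mul hW0.le, hW, Real.mul_rpow hκ0.le (by positivity), ← Real.rpow_natCast R n,
      ← Real.rpow_mul hR.le]
    congr 2 <;> field_simp
  have e2 : W ^ ((k : ℝ) / n) = κ ^ ((k : ℝ) / n) * R ^ k := by
    rw [hW, Real.mul_rpow hκ0.le (by positivity), ← Real.rpow_natCast R n,
      ← Real.rpow_mul hR.le, mul_div_cancel₀ _ hn', Real.rpow_natCast]
  have e3 : W * W + W * (2 * R) ^ (n : ℝ) = W * W * (1 + 2 ^ n / κ) := by
    rw [Real.rpow_natCast, mul_pow, hW]; field_simp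
  rw [e1, e2, e3, Real.mul_rpow (by norm_num) hR.le, campConst, ← hκ]
  have p1 : 0 < κ ^ (σ / n) := by positivity
  have p2 : 0 < κ ^ ((k : ℝ) / n) := by positivity
  have p3 : 0 < R ^ σ := by positivity
  have e4 : (2 * (2 * R * 2 ^ n)) ^ k = (4 * 2 ^ n) ^ k * R ^ k := by
    rw [← mul_pow]; ring
  rw [e4, mul_pow (4 * 2 ^ n : ℝ)]
  field_simp

theorem oscQuotK_le {n k : ℕ} (hn : 0 < n) {σ : ℝ} (hσ : 0 ≤ σ) {A : ℝ → ℝ≥0∞}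
    (hA : IsYoung A) {u : Euc n → ℝ} {D : (h : ℕ) → Euc n → (Fin h → Fin n) → ℝ}
    (hD : HasWeakDerivs n k u D) {lam : ℝ} (hlam : 0 < lam)
    (hJ : Jfun n σ A (fun x d => D k x d / lam) ≤ 1) (x₀ : Euc n) {R : ℝ} (hR : 0 < R) :
    oscQuotK n k (fun r => r ^ σ * rcInv A (ENNReal.ofReal (r ^ (-(n : ℝ))))) u D x₀ R ≤
      ENNReal.ofReal (campConst n k σ * lam) := by
  obtain ⟨P, hP⟩ := hD.exists_isCampPoly x₀ hR
  refine (iInf₂_le P hP).trans ?_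
  set V := volume (ball x₀ R) with hV
  have hVtop : V ≠ ⊤ := measure_ball_lt_top.ne
  have hV0 : V ≠ 0 := (measure_ball_pos _ _ hR).ne'
  set W := V.toReal with hW
  have hW0 : 0 < W := ENNReal.toReal_pos hV0 hVtop
  have hVW : V = ENNReal.ofReal W := (ENNReal.ofReal_toReal hVtop).symm
  have hpow : (W ^ ((n : ℝ)⁻¹)) ^ (-(n : ℝ)) = W⁻¹ := by
    have hn' : (n : ℝ) ≠ 0 := by positivity
    rw [← Real.rpow_mul hW0.le, mul_neg, inv_mul_cancel₀ hn', Real.rpow_neg_one]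
  simp only [hpow]
  set w := ENNReal.ofReal W⁻¹ with hw
  have hw0 : w ≠ 0 := by positivity
  have hwinv : w⁻¹ = ENNReal.ofReal W := by
    rw [hw, ENNReal.ofReal_inv_of_pos hW0, inv_inv]
  set τ := rcInv A w with hτ
  have hτ0 : 0 < τ := hA.rcInv_pos hw0 ENNReal.ofReal_ne_top
  have hM : ∀ (d : Fin k → Fin n) (x₁ : Euc n),
      ∫⁻ x in ball x₁ R, ∫⁻ y in ball x₁ R, ‖D k x d - D k y d‖ₑ ≤
      ENNReal.ofReal (lam * (2 * R) ^ σ *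
        (2 * τ * (W * W + W * (2 * R) ^ (n : ℝ)))) := by
    intro d x₁
    refine (lintegral_lintegral_le_of_Jfun_le_one hA hσ hlam hJ hw0 ENNReal.ofReal_ne_top d x₁
      hR).trans_eq ?_
    have hvol : volume (ball x₁ R) = ENNReal.ofReal W := by
      rw [← hVW, hV, Measure.addHaar_ball_center volume x₁, Measure.addHaar_ball_center volume x₀]
    rw [hvol, hwinv, ← ENNReal.ofReal_mul hW0.le, ← ENNReal.ofReal_mul hW0.le,
      ← ENNReal.ofReal_add (by positivity) (by positivity), ← ENNReal.ofReal_mul (by positivity),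
      ← ENNReal.ofReal_mul (by positivity)]
  have hmain := hD.lintegral_sub_polyFun_le x₀ hR hM hP
  have hmean : ENNReal.ofReal (∫ y in ball x₀ R, |u y - MvPolynomial.eval (fun i => y i) P|) ≤
      ∫⁻ x in ball x₀ R, ‖u x - polyFun P x‖ₑ := by
    refine (Real.ofReal_le_enorm _).trans ((enorm_integral_le_lintegral_enorm _).trans_eq ?_)
    refine lintegral_congr fun x => ?_
    rw [← Real.norm_eq_abs, enorm_norm]
    rfl
  have hWe : W = (volume (ball (0 : Euc n) 1)).toReal * R ^ n := toReal_volume_ball n x₀ hR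
  set E := ((W ^ ((n : ℝ)⁻¹)) ^ σ * τ * W ^ ((k : ℝ) / n))⁻¹ * W⁻¹ with hE
  have hE0 : 0 ≤ E := by positivity
  rw [setAverage_eq, smul_eq_mul, ← mul_assoc, Measure.real, ← hV, ← hW, ← hE,
    ENNReal.ofReal_mul hE0, ← campConst_mul_eq hn k σ lam rfl hR hτ0 hWe, ← hE,
    ENNReal.ofReal_mul hE0]
  refine mul_le_mul' le_rfl (hmean.trans (hmain.trans_eq ?_))
  rw [← hV, hVW, ← ENNReal.ofReal_inv_of_pos hW0, ← ENNReal.ofReal_mul (by positivity),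
    ← ENNReal.ofReal_natCast, ← ENNReal.ofReal_pow (by positivity),
    ← ENNReal.ofReal_mul (by positivity), ← ENNReal.ofReal_ofNat,
    ← ENNReal.ofReal_pow (by positivity),
    ← ENNReal.ofReal_mul (by positivity), ← ENNReal.ofReal_mul (by positivity),
    ← ENNReal.ofReal_pow (by positivity),
    ← ENNReal.ofReal_mul (by positivity)]

end CampanatoBound

end

/-- Optimal embedding of `V^{s,A}(ℝⁿ)` into the `[s]`-th order
Campanato space `𝓛^{[s],ψ^{[s]}_{s,A}}(ℝⁿ)`, where `ψ^{[s]}_{s,A}(r) = r^{{s}} A⁻¹(r^{-n})`. -/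
theorem stmt14 (n : ℕ) (hn : 0 < n) (s : ℝ) (hs1 : 1 < s) (hs2 : ∀ m : ℕ, s ≠ (m : ℝ))
    (hsk : s < (n : ℝ) + (⌊s⌋₊ : ℝ) + 1) :
    ∃ c : ℝ, 0 < c ∧ ∀ A : ℝ → ℝ≥0∞, IsYoung A →
      ∀ (u : Euc n → ℝ) (D : (h : ℕ) → Euc n → (Fin h → Fin n) → ℝ),
        HasWeakDerivs n ⌊s⌋₊ u D →
        fracSem n (s - (⌊s⌋₊ : ℝ)) A (D ⌊s⌋₊) < ⊤ →
        campSemK n ⌊s⌋₊ (psiTop n s A) u D ≤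
          ENNReal.ofReal c * fracSem n (s - (⌊s⌋₊ : ℝ)) A (D ⌊s⌋₊) := by
  have hσ : 0 ≤ s - (⌊s⌋₊ : ℝ) := sub_nonneg.2 (Nat.floor_le (by linarith))
  have hc := campConst_pos hn ⌊s⌋₊ (s - (⌊s⌋₊ : ℝ))
  refine ⟨campConst n ⌊s⌋₊ (s - (⌊s⌋₊ : ℝ)), hc, fun A hA u D hD _ => ?_⟩
  refine iSup_le fun x => iSup_le fun r => iSup_le fun hr => ?_
  have hc0 : ENNReal.ofReal (campConst n ⌊s⌋₊ (s - (⌊s⌋₊ : ℝ))) ≠ 0 :=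
    (ENNReal.ofReal_pos.2 hc).ne'
  rw [← ENNReal.div_le_iff' hc0 ENNReal.ofReal_ne_top]
  refine le_sInf ?_
  rintro _ ⟨lam, ⟨hlam, hJ⟩, rfl⟩
  rw [ENNReal.div_le_iff' hc0 ENNReal.ofReal_ne_top, ← ENNReal.ofReal_mul hc.le]
  exact oscQuotK_le hn hσ hA hD hlam hJ x hr
end
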